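/- Let X be a GC_5 set of 21 nodes with no maximal line. Then no node of X has m-distribution sequence (5,5,4,3,3), and no node of X has m-distribution sequence (5,4,4,4,3). -/

import Mathlib

open MvPolynomial

/-- Evaluation of a bivariate polynomial at a point of the real plane. -/
noncomputable def ev (p : MvPolynomial (Fin 2) ℝ) (A : ℝ × ℝ) : ℝ :=
  MvPolynomial.eval ![A.1, A.2] p

/-- A polynomial of total degree exactly 1, defining a line. -/
def IsLinePoly (l : MvPolynomial (Fin 2) ℝ) : Prop := l.totalDegree = 1

/-- The line (zero set) defined by a polynomial. -/
def lineSet (l : MvPolynomial (Fin 2) ℝ) : Set (ℝ × ℝ) := {A | ev l A = 0}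

/-- The number of nodes of `X` lying on the line defined by `l`. -/
noncomputable def nodesOn (X : Set (ℝ × ℝ)) (l : MvPolynomial (Fin 2) ℝ) : ℕ :=
  (X ∩ lineSet l).ncard

/-- `X` is an `n`-poised set: it has `N = (n+2)(n+1)/2` nodes and the only polynomial of
degree ≤ n vanishing on all of `X` is the zero polynomial. -/
def Poised (n : ℕ) (X : Set (ℝ × ℝ)) : Prop :=
  X.Finite ∧ X.ncard = (n + 2) * (n + 1) / 2 ∧
    ∀ p : MvPolynomial (Fin 2) ℝ, p.totalDegree ≤ n → (∀ A ∈ X, ev p A = 0) → p = 0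

/-- `p` is an `n`-fundamental polynomial of the node `A` with respect to `X`. -/
def IsFund (n : ℕ) (X : Set (ℝ × ℝ)) (A : ℝ × ℝ) (p : MvPolynomial (Fin 2) ℝ) : Prop :=
  p.totalDegree ≤ n ∧ ev p A = 1 ∧ ∀ B ∈ X, B ≠ A → ev p B = 0

/-- `X` is a `GC_n` set: it is `n`-poised and each fundamental polynomial is a product of
`n` linear (degree-1) polynomials. -/
def GCSet (n : ℕ) (X : Set (ℝ × ℝ)) : Prop :=
  Poised n X ∧ ∀ A ∈ X, ∃ p : MvPolynomial (Fin 2) ℝ, IsFund n X A p ∧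
    ∃ f : Fin n → MvPolynomial (Fin 2) ℝ, (∀ i, IsLinePoly (f i)) ∧ p = ∏ i, f i

/-- The node `A` uses the line `l`: the linear polynomial `l` divides a fundamental
polynomial of `A`. -/
def Uses (n : ℕ) (X : Set (ℝ × ℝ)) (A : ℝ × ℝ) (l : MvPolynomial (Fin 2) ℝ) : Prop :=
  ∃ p, IsFund n X A p ∧ l ∣ p

/-- `X` has no maximal line, i.e. no line passes through `n+1` nodes of `X`. -/
def NoMaximalLine (n : ℕ) (X : Set (ℝ × ℝ)) : Prop :=
  ∀ l : MvPolynomial (Fin 2) ℝ, IsLinePoly l → nodesOn X l ≠ n + 1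

/-- Number of nodes of `X` on the line `l` which do not lie on any of the lines
`L 0, …, L (s-1)` (the primary node count of `l` at step `s`). -/
noncomputable def resCount (X : Set (ℝ × ℝ)) (L : Fin 5 → MvPolynomial (Fin 2) ℝ)
    (s : Fin 5) (l : MvPolynomial (Fin 2) ℝ) : ℕ :=
  {B ∈ X | ev l B = 0 ∧ ∀ i : Fin 5, i < s → ev (L i) B ≠ 0}.ncard

/-- `L` is an m-line sequence of the node `A` of the `GC_5` set `X`: it enumerates the five
distinct used lines of `A` (a fundamental polynomial of `A` is, up to a constant, the
product of the `L i`), ordered greedily: at each step `s` the line `L s` has maximal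
primary node count among the remaining used lines. -/
def MLineSeq (X : Set (ℝ × ℝ)) (A : ℝ × ℝ) (L : Fin 5 → MvPolynomial (Fin 2) ℝ) : Prop :=
  (∀ i, IsLinePoly (L i)) ∧
  (∀ i j : Fin 5, i ≠ j → lineSet (L i) ≠ lineSet (L j)) ∧
  (∃ p : MvPolynomial (Fin 2) ℝ, IsFund 5 X A p ∧ ∃ c : ℝ, p = MvPolynomial.C c * ∏ i, L i) ∧
  (∀ s t : Fin 5, s ≤ t → resCount X L s (L t) ≤ resCount X L s (L s))

/-- The node `A` has m-distribution sequence `k`. -/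
def HasMDSeq (X : Set (ℝ × ℝ)) (A : ℝ × ℝ) (k : Fin 5 → ℕ) : Prop :=
  ∃ L : Fin 5 → MvPolynomial (Fin 2) ℝ, MLineSeq X A L ∧ ∀ s, resCount X L s (L s) = k s

/-- The affine function on the plane with coefficients `v`. -/
def aff (v : Fin 3 → ℝ) (P : ℝ × ℝ) : ℝ := v 0 * P.1 + v 1 * P.2 + v 2

/-- A set of points of the plane is a line. -/
def IsLn (u : Set (ℝ × ℝ)) : Prop :=
  ∃ v : Fin 3 → ℝ, (v 0 ≠ 0 ∨ v 1 ≠ 0) ∧ u = {P | aff v P = 0}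

/-- The line joining two points. -/
def join (P Q : ℝ × ℝ) : Set (ℝ × ℝ) :=
  {R | aff ![P.2 - Q.2, Q.1 - P.1, P.1 * Q.2 - Q.1 * P.2] R = 0}

lemma left_mem_join (P Q : ℝ × ℝ) : P ∈ join P Q := by
  simp only [join, aff, Set.mem_ofPred_eq, Matrix.cons_val]; ring

lemma right_mem_join (P Q : ℝ × ℝ) : Q ∈ join P Q := by
  simp only [join, aff, Set.mem_ofPred_eq, Matrix.cons_val]; ring

lemma isLn_join {P Q : ℝ × ℝ} (h : P ≠ Q) : IsLn (join P Q) := by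
  refine ⟨_, ?_, rfl⟩
  simp only [Matrix.cons_val]
  by_contra! h'
  exact h (Prod.ext (by linarith [h'.2]) (by linarith [h'.1]))

lemma IsLn.eq_join {u : Set (ℝ × ℝ)} (hu : IsLn u) {P Q : ℝ × ℝ} (h : P ≠ Q)
    (hP : P ∈ u) (hQ : Q ∈ u) : u = join P Q := by
  obtain ⟨v, hv, rfl⟩ := hu
  simp only [aff, Set.mem_ofPred_eq] at hP hQ
  have key : ∃ k : ℝ, k ≠ 0 ∧ v 0 = k * (P.2 - Q.2) ∧ v 1 = k * (Q.1 - P.1) := by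
    by_cases h1 : Q.1 - P.1 = 0
    · have h2 : P.2 - Q.2 ≠ 0 := fun h2 => h (Prod.ext (by linarith) (by linarith))
      have h3 : v 1 = 0 := by
        have : v 1 * (P.2 - Q.2) = 0 := by linear_combination hP - hQ + v 0 * h1
        exact (mul_eq_zero.mp this).resolve_right h2
      have h4 : v 0 ≠ 0 := hv.resolve_right (by simp [h3])
      refine ⟨v 0 / (P.2 - Q.2), div_ne_zero h4 h2, by field_simp, by rw [h1, h3, mul_zero]⟩
    · refine ⟨v 1 / (Q.1 - P.1), ?_, ?_, by field_simp⟩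
      · intro h0
        have h3 : v 1 = 0 := (div_eq_zero_iff.mp h0).resolve_right h1
        have : v 0 * (Q.1 - P.1) = 0 := by
          linear_combination hQ - hP + (P.2 - Q.2) * h3
        rcases mul_eq_zero.mp this with h4 | h4
        · exact hv.elim (fun h => h h4) (fun h => h h3)
        · exact h1 h4
      · field_simp
        linear_combination hQ - hP
  obtain ⟨k, hk, h0, h1⟩ := key
  ext R
  simp only [join, aff, Set.mem_ofPred_eq, Matrix.cons_val]
  have : v 0 * R.1 + v 1 * R.2 + v 2 = k * ((P.2 - Q.2) * R.1 + (Q.1 - P.1) * R.2 +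
      (P.1 * Q.2 - Q.1 * P.2)) := by
    rw [h0, h1] at hP ⊢
    linear_combination hP
  rw [this, mul_eq_zero, or_iff_right hk]

lemma IsLn.eq_of_mem {u w : Set (ℝ × ℝ)} (hu : IsLn u) (hw : IsLn w) {P Q : ℝ × ℝ}
    (h : P ≠ Q) (hPu : P ∈ u) (hQu : Q ∈ u) (hPw : P ∈ w) (hQw : Q ∈ w) : u = w :=
  (hu.eq_join h hPu hQu).trans (hw.eq_join h hPw hQw).symm

lemma IsLn.infinite {u : Set (ℝ × ℝ)} (hu : IsLn u) : u.Infinite := by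
  obtain ⟨v, hv, rfl⟩ := hu
  by_cases h : v 1 = 0
  · have h0 : v 0 ≠ 0 := hv.resolve_right (by simp [h])
    refine Set.infinite_of_injective_forall_mem (f := fun y : ℝ => ((-v 2 / v 0, y) : ℝ × ℝ))
      (fun a b hab => (Prod.ext_iff.mp hab).2) fun y => ?_
    simp only [aff, Set.mem_ofPred_eq, h]
    field_simp
    ring
  · refine Set.infinite_of_injective_forall_mem
      (f := fun x : ℝ => ((x, (-v 2 - v 0 * x) / v 1) : ℝ × ℝ))
      (fun a b hab => (Prod.ext_iff.mp hab).1) fun y => ?_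
    simp only [aff, Set.mem_ofPred_eq]
    field_simp
    ring

/-- An equation of the line `u`. -/
noncomputable def form (u : Set (ℝ × ℝ)) : Fin 3 → ℝ :=
  open scoped Classical in if h : IsLn u then h.choose else 0

lemma IsLn.mem_iff {u : Set (ℝ × ℝ)} (hu : IsLn u) {P : ℝ × ℝ} :
    P ∈ u ↔ aff (form u) P = 0 := by
  rw [form, dif_pos hu]
  exact Set.ext_iff.mp hu.choose_spec.2 P

/-- Polynomial functions of degree at most `n` on the plane. -/
def PF (n : ℕ) : Submodule ℝ (ℝ × ℝ → ℝ) :=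
  Submodule.span ℝ {f | ∃ i j : ℕ, i + j ≤ n ∧ f = fun P => P.1 ^ i * P.2 ^ j}

lemma aff_mem_PF (v : Fin 3 → ℝ) : aff v ∈ PF 1 := by
  have h : aff v = v 0 • (fun P : ℝ × ℝ => P.1 ^ 1 * P.2 ^ 0) +
      v 1 • (fun P : ℝ × ℝ => P.1 ^ 0 * P.2 ^ 1) + v 2 • (fun P => P.1 ^ 0 * P.2 ^ 0) := by
    ext P; simp [aff]
  rw [h]
  exact add_mem (add_mem (Submodule.smul_mem _ _ (Submodule.subset_span ⟨1, 0, by simp, rfl⟩))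
    (Submodule.smul_mem _ _ (Submodule.subset_span ⟨0, 1, by simp, rfl⟩)))
    (Submodule.smul_mem _ _ (Submodule.subset_span ⟨0, 0, by simp, rfl⟩))

lemma PF_mono {m n : ℕ} (h : m ≤ n) : PF m ≤ PF n := by
  apply Submodule.span_mono
  rintro f ⟨i, j, hij, rfl⟩
  exact ⟨i, j, hij.trans h, rfl⟩

lemma mul_mem_PF {m n : ℕ} {f g : ℝ × ℝ → ℝ} (hf : f ∈ PF m) (hg : g ∈ PF n) :
    f * g ∈ PF (m + n) := by
  have h : PF m * PF n ≤ PF (m + n) := by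
    rw [PF, PF, Submodule.span_mul_span]
    apply Submodule.span_mono
    rintro _ ⟨_, ⟨i, j, hij, rfl⟩, _, ⟨k, l, hkl, rfl⟩, rfl⟩
    exact ⟨i + k, j + l, by omega, by ext P; simp only [Pi.mul_apply]; ring⟩
  exact h (Submodule.mul_mem_mul hf hg)

lemma exists_poly_of_mem_PF {n : ℕ} {f : ℝ × ℝ → ℝ} (hf : f ∈ PF n) :
    ∃ p : MvPolynomial (Fin 2) ℝ, p.totalDegree ≤ n ∧
      ∀ P : ℝ × ℝ, MvPolynomial.eval ![P.1, P.2] p = f P := by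
  induction hf using Submodule.span_induction with
  | mem f hf =>
    obtain ⟨i, j, hij, rfl⟩ := hf
    refine ⟨X 0 ^ i * X 1 ^ j, ?_, fun P => by simp⟩
    calc _ ≤ _ := totalDegree_mul _ _
      _ ≤ i + j := by simp [totalDegree_X_pow]
      _ ≤ n := hij
  | zero => exact ⟨0, by simp, by simp⟩
  | add f g _ _ hf hg =>
    obtain ⟨p, hp, hp'⟩ := hf
    obtain ⟨q, hq, hq'⟩ := hg
    exact ⟨p + q, (totalDegree_add _ _).trans (max_le hp hq), fun P => by simp [hp', hq']⟩
  | smul a f _ hf =>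
    obtain ⟨p, hp, hp'⟩ := hf
    exact ⟨a • p, (totalDegree_smul_le _ _).trans hp, fun P => by simp [hp', smul_eval]⟩

lemma eq_zero_or_eq_zero_of_PF {m n : ℕ} {f g : ℝ × ℝ → ℝ} (hf : f ∈ PF m) (hg : g ∈ PF n)
    (h : f * g = 0) : f = 0 ∨ g = 0 := by
  obtain ⟨p, -, hp⟩ := exists_poly_of_mem_PF hf
  obtain ⟨q, -, hq⟩ := exists_poly_of_mem_PF hg
  have hpq : p * q = 0 := by
    apply MvPolynomial.funext
    intro x
    have hx : x = ![x 0, x 1] := by ext i; fin_cases i <;> rfl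
    rw [hx, map_mul, hp (x 0, x 1), hq (x 0, x 1), map_zero]
    exact congrFun h (x 0, x 1)
  rcases mul_eq_zero.mp hpq with h | h
  · left; ext P; rw [← hp P, h]; simp
  · right; ext P; rw [← hq P, h]; simp

/-- The product of the equations of the lines in `s`. -/
noncomputable def pr (s : Finset (Set (ℝ × ℝ))) (P : ℝ × ℝ) : ℝ := ∏ u ∈ s, aff (form u) P

lemma pr_mem_PF (s : Finset (Set (ℝ × ℝ))) : pr s ∈ PF s.card := by
  classical
  induction s using Finset.induction_on with
  | empty =>
    exact Submodule.subset_span ⟨0, 0, by simp, by ext P; simp [pr]⟩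
  | insert u s hu ih =>
    have : pr (insert u s) = aff (form u) * pr s := by
      ext P; simp [pr, Finset.prod_insert hu]
    rw [this, Finset.card_insert_of_notMem hu, add_comm]
    exact mul_mem_PF (aff_mem_PF _) ih

lemma pr_eq_zero_iff {s : Finset (Set (ℝ × ℝ))} (hs : ∀ u ∈ s, IsLn u) {P : ℝ × ℝ} :
    pr s P = 0 ↔ ∃ u ∈ s, P ∈ u := by
  rw [pr, Finset.prod_eq_zero_iff]
  exact exists_congr fun u => and_congr_right fun hu => (hs u hu).mem_iff.symm

lemma card_le_card_of_cover {s : Finset (Set (ℝ × ℝ))} (hs : ∀ u ∈ s, IsLn u)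
    {w : Set (ℝ × ℝ)} (hw : IsLn w) (hws : w ∉ s) {S : Finset (ℝ × ℝ)} (hS : ∀ P ∈ S, P ∈ w)
    (hcov : ∀ P ∈ S, ∃ u ∈ s, P ∈ u) : S.card ≤ s.card := by
  choose! φ hφ hφ' using hcov
  refine Finset.card_le_card_of_injOn φ hφ fun P hP Q hQ hPQ => ?_
  by_contra hne
  have := hw.eq_of_mem (hs _ (hφ P hP)) hne (hS P hP) (hS Q hQ) (hφ' P hP)
    (hPQ ▸ hφ' Q hQ)
  exact hws (this ▸ hφ P hP)

lemma IsLn.mem_of_forall_mem {s : Finset (Set (ℝ × ℝ))} (hs : ∀ u ∈ s, IsLn u)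
    {w : Set (ℝ × ℝ)} (hw : IsLn w) (hcov : ∀ P ∈ w, ∃ u ∈ s, P ∈ u) : w ∈ s := by
  by_contra h
  obtain ⟨S, hS, hc⟩ := hw.infinite.exists_subset_card_eq (s.card + 1)
  have := card_le_card_of_cover hs hw h (S := S) (fun P hP => hS hP) (fun P hP => hcov P (hS hP))
  omega

lemma exists_notMem_lines {s : Finset (Set (ℝ × ℝ))} (hs : ∀ u ∈ s, IsLn u) :
    ∃ P, ∀ u ∈ s, P ∉ u := by
  by_contra! h
  have hall : ∀ w, IsLn w → w ∈ s := fun w hw => hw.mem_of_forall_mem hs fun P _ => h P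
  refine (Set.infinite_of_injective_forall_mem (s := (s : Set (Set (ℝ × ℝ))))
    (f := fun y : ℝ => join (0, y) (1, y)) (fun a b hab => ?_) fun y => ?_) s.finite_toSet
  · have hab' : join (0, a) (1, a) = join (0, b) (1, b) := hab
    have : ((0 : ℝ), a) ∈ join (0, b) (1, b) := hab' ▸ left_mem_join _ _
    simp only [join, aff, Set.mem_ofPred_eq, Matrix.cons_val] at this
    linarith
  · exact hall _ (isLn_join (by simp))

lemma exists_notMem_lines_on {s : Finset (Set (ℝ × ℝ))} (hs : ∀ u ∈ s, IsLn u)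
    {w : Set (ℝ × ℝ)} (hw : IsLn w) (hws : w ∉ s) : ∃ P ∈ w, ∀ u ∈ s, P ∉ u := by
  by_contra! h
  exact hws (hw.mem_of_forall_mem hs h)

lemma exists_nontrivial_solution {ι κ : Type*} [Fintype ι] [Fintype κ]
    (h : Fintype.card κ < Fintype.card ι) (M : κ → ι → ℝ) :
    ∃ c : ι → ℝ, c ≠ 0 ∧ ∀ k, ∑ i, M k i * c i = 0 := by
  classical
  have h' := LinearMap.ker_ne_bot_of_finrank_lt (f := Matrix.toLin' (Matrix.of M))
    (by simpa using h)
  obtain ⟨c, hc, hc0⟩ := Submodule.exists_mem_ne_zero_of_ne_bot h'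
  refine ⟨c, hc0, fun k => ?_⟩
  have := congrFun (LinearMap.mem_ker.mp hc) k
  simpa [Matrix.mulVec, dotProduct] using this

section Nodes
open scoped Classical

/-- The points of `S` on `u`. -/
noncomputable def nod (S : Finset (ℝ × ℝ)) (u : Set (ℝ × ℝ)) : Finset (ℝ × ℝ) :=
  S.filter (· ∈ u)

/-- The points of `S` off `u`. -/
noncomputable def off (S : Finset (ℝ × ℝ)) (u : Set (ℝ × ℝ)) : Finset (ℝ × ℝ) :=
  S.filter (· ∉ u)

lemma mem_nod {S : Finset (ℝ × ℝ)} {u : Set (ℝ × ℝ)} {P : ℝ × ℝ} :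
    P ∈ nod S u ↔ P ∈ S ∧ P ∈ u := Finset.mem_filter

lemma mem_off {S : Finset (ℝ × ℝ)} {u : Set (ℝ × ℝ)} {P : ℝ × ℝ} :
    P ∈ off S u ↔ P ∈ S ∧ P ∉ u := Finset.mem_filter

lemma card_nod_add_card_off (S : Finset (ℝ × ℝ)) (u : Set (ℝ × ℝ)) :
    (nod S u).card + (off S u).card = S.card :=
  Finset.card_filter_add_card_filter_not _

lemma off_subset (S : Finset (ℝ × ℝ)) (u : Set (ℝ × ℝ)) : off S u ⊆ S := Finset.filter_subset _ _

lemma nod_subset (S : Finset (ℝ × ℝ)) (u : Set (ℝ × ℝ)) : nod S u ⊆ S := Finset.filter_subset _ _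

lemma nod_mono {S S' : Finset (ℝ × ℝ)} (h : S ⊆ S') (u : Set (ℝ × ℝ)) : nod S u ⊆ nod S' u :=
  Finset.filter_subset_filter _ h

/-- The linear functional with weights `c` on `K` annihilates the polynomials of degree at most
`n`. -/
def Dep (n : ℕ) (K : Finset (ℝ × ℝ)) (c : ℝ × ℝ → ℝ) : Prop :=
  ∀ g ∈ PF n, ∑ B ∈ K, c B * g B = 0

lemma exists_dep {S : Finset (ℝ × ℝ)} (h : 15 < S.card) :
    ∃ c, (∃ B ∈ S, c B ≠ 0) ∧ Dep 4 S c := by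
  set κ : Finset (ℕ × ℕ) := (Finset.range 5 ×ˢ Finset.range 5).filter fun p => p.1 + p.2 ≤ 4
    with hκ
  have hκc : κ.card = 15 := by rw [hκ]; decide
  obtain ⟨c, hc, hM⟩ := exists_nontrivial_solution (ι := S) (κ := κ)
    (by simpa [hκc] using h) (fun k P => P.1.1 ^ k.1.1 * P.1.2 ^ k.1.2)
  refine ⟨fun P => if hP : P ∈ S then c ⟨P, hP⟩ else 0, ?_, fun g hg => ?_⟩
  · obtain ⟨B, hB⟩ := Function.ne_iff.mp hc
    exact ⟨B, B.2, by simpa using hB⟩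
  · rw [← Finset.sum_coe_sort]
    simp only [Finset.coe_mem, dite_true]
    induction hg using Submodule.span_induction with
    | mem f hf =>
      obtain ⟨i, j, hij, rfl⟩ := hf
      rw [← hM ⟨(i, j), by simp [hκ]; omega⟩]
      exact Finset.sum_congr rfl fun _ _ => mul_comm _ _
    | zero => simp
    | add f g _ _ hf hg => simp only [Pi.add_apply, mul_add, Finset.sum_add_distrib, hf, hg, add_zero]
    | smul a f _ hf =>
      simp only [Pi.smul_apply, smul_eq_mul, mul_left_comm _ a, ← Finset.mul_sum, hf, mul_zero]

lemma Dep.mono_of_zero {n : ℕ} {K K' : Finset (ℝ × ℝ)} {c : ℝ × ℝ → ℝ} (h : Dep n K c)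
    (hK : K' ⊆ K) (hc : ∀ B ∈ K, B ∉ K' → c B = 0) : Dep n K' c := fun g hg => by
  rw [← h g hg]
  exact Finset.sum_subset hK fun B hB hB' => by rw [hc B hB hB', zero_mul]

lemma Dep.eq_zero {n : ℕ} {K : Finset (ℝ × ℝ)} {c : ℝ × ℝ → ℝ} (h : Dep n K c)
    (hK : K.card ≤ n + 1) : ∀ B ∈ K, c B = 0 := by
  intro B hB
  let φ : ℝ × ℝ → Fin 3 → ℝ := fun Q =>
    ![B.1 - Q.1, B.2 - Q.2, -((B.1 - Q.1) * Q.1 + (B.2 - Q.2) * Q.2)]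
  have hφ : ∀ T : Finset (ℝ × ℝ), (fun P => ∏ Q ∈ T, aff (φ Q) P) ∈ PF T.card := by
    intro T
    induction T using Finset.induction_on with
    | empty => exact Submodule.subset_span ⟨0, 0, by simp, by ext P; simp⟩
    | insert Q T hQ ih =>
      have : (fun P => ∏ Q ∈ insert Q T, aff (φ Q) P) =
          aff (φ Q) * fun P => ∏ Q ∈ T, aff (φ Q) P := by
        ext P; simp [Finset.prod_insert hQ]
      rw [this, Finset.card_insert_of_notMem hQ, add_comm]
      exact mul_mem_PF (aff_mem_PF _) ih
  have h1 := h _ (PF_mono (by rw [Finset.card_erase_of_mem hB]; omega) (hφ (K.erase B)))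
  rw [Finset.sum_eq_single B] at h1
  · refine (mul_eq_zero.mp h1).resolve_right (Finset.prod_ne_zero_iff.mpr fun Q hQ h0 => ?_)
    have h2 : (B.1 - Q.1) ^ 2 + (B.2 - Q.2) ^ 2 = 0 := by
      simp only [aff, φ, Matrix.cons_val] at h0
      linear_combination h0
    have h3 : B.1 - Q.1 = 0 := by nlinarith [sq_nonneg (B.1 - Q.1), sq_nonneg (B.2 - Q.2)]
    have h4 : B.2 - Q.2 = 0 := by nlinarith [sq_nonneg (B.1 - Q.1), sq_nonneg (B.2 - Q.2)]
    exact (Finset.mem_erase.mp hQ).1 (Prod.ext (by linarith) (by linarith))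
  · intro P hP hPB
    rw [mul_eq_zero]; right
    refine Finset.prod_eq_zero (Finset.mem_erase.mpr ⟨hPB, hP⟩) ?_
    simp only [aff, φ, Matrix.cons_val]; ring
  · exact fun h => absurd hB h

lemma Dep.peel {n : ℕ} {K : Finset (ℝ × ℝ)} {v : Set (ℝ × ℝ)} (hv : IsLn v)
    (hn : (nod K v).card ≤ n + 2)
    (ih : ∀ c, Dep n (off K v) c → ∀ B ∈ off K v, c B = 0) :
    ∀ c, Dep (n + 1) K c → ∀ B ∈ K, c B = 0 := by
  intro c h
  have h1 : Dep n (off K v) fun P => c P * aff (form v) P := fun g hg => by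
    have := h _ ((add_comm 1 n) ▸ mul_mem_PF (aff_mem_PF (form v)) hg)
    rw [← this]
    simp only [Pi.mul_apply, ← mul_assoc]
    refine Finset.sum_subset (Finset.filter_subset _ _) fun B hB hB' => ?_
    have : B ∈ v := by by_contra hv; exact hB' (mem_off.mpr ⟨hB, hv⟩)
    rw [hv.mem_iff.mp this]; simp
  have h2 : ∀ B ∈ off K v, c B = 0 := fun B hB =>
    (mul_eq_zero.mp (ih _ h1 B hB)).resolve_right fun h0 => (mem_off.mp hB).2 (hv.mem_iff.mpr h0)
  have h3 : Dep (n + 1) (nod K v) c := h.mono_of_zero (Finset.filter_subset _ _) fun B hB hB' =>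
    h2 B (mem_off.mpr ⟨hB, fun hv => hB' (mem_nod.mpr ⟨hB, hv⟩)⟩)
  intro B hB
  by_cases hBv : B ∈ v
  · exact h3.eq_zero hn B (mem_nod.mpr ⟨hB, hBv⟩)
  · exact h2 B (mem_off.mpr ⟨hB, hBv⟩)

lemma Dep.peel_four {K : Finset (ℝ × ℝ)} {v₁ v₂ v₃ v₄ : Set (ℝ × ℝ)} (h1 : IsLn v₁)
    (h2 : IsLn v₂) (h3 : IsLn v₃) (k1 : (nod K v₁).card ≤ 5)
    (k2 : (nod (off K v₁) v₂).card ≤ 4) (k3 : (nod (off (off K v₁) v₂) v₃).card ≤ 3)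
    (k4 : (nod (off (off (off K v₁) v₂) v₃) v₄).card ≤ 2)
    (hK : ∀ B ∈ K, B ∈ v₁ ∨ B ∈ v₂ ∨ B ∈ v₃ ∨ B ∈ v₄)
    {c : ℝ × ℝ → ℝ} (hc : Dep 4 K c) : ∀ B ∈ K, c B = 0 := by
  refine Dep.peel h1 k1 (Dep.peel h2 k2 (Dep.peel h3 k3 fun c hc => hc.eq_zero ?_)) c hc
  refine (Finset.card_le_card fun B hB => ?_).trans k4
  have := hB
  simp only [mem_off] at this
  have := hK B this.1.1.1
  rw [mem_nod]
  tauto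

/-- A set of 21 nodes without 6-node lines, together with the five lines used by each node. -/
structure Config (X : Finset (ℝ × ℝ)) (us : ℝ × ℝ → Finset (Set (ℝ × ℝ))) : Prop where
  card : X.card = 21
  line : ∀ A ∈ X, ∀ u ∈ us A, IsLn u
  five : ∀ A ∈ X, (us A).card = 5
  avoid : ∀ A ∈ X, ∀ u ∈ us A, A ∉ u
  cover : ∀ A ∈ X, ∀ B ∈ X, B ≠ A → ∃ u ∈ us A, B ∈ u
  le5 : ∀ u, IsLn u → (nod X u).card ≤ 5
  poised : ∀ f ∈ PF 5, (∀ P ∈ X, f P = 0) → f = 0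

/-- The nodes using the line `u`. -/
noncomputable def usr (X : Finset (ℝ × ℝ)) (us : ℝ × ℝ → Finset (Set (ℝ × ℝ)))
    (u : Set (ℝ × ℝ)) : Finset (ℝ × ℝ) := X.filter (u ∈ us ·)

lemma mem_usr {X : Finset (ℝ × ℝ)} {us : ℝ × ℝ → Finset (Set (ℝ × ℝ))} {u : Set (ℝ × ℝ)}
    {A : ℝ × ℝ} : A ∈ usr X us u ↔ A ∈ X ∧ u ∈ us A := Finset.mem_filter

/-- Three 5-node lines no two of which share a node. -/
structure IsT (X : Finset (ℝ × ℝ)) (t : Finset (Set (ℝ × ℝ))) : Prop where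
  card : t.card = 3
  line : ∀ u ∈ t, IsLn u
  five : ∀ u ∈ t, (nod X u).card = 5
  disj : ∀ u ∈ t, ∀ v ∈ t, u ≠ v → ∀ P ∈ X, P ∈ u → P ∉ v

variable {X : Finset (ℝ × ℝ)} {us : ℝ × ℝ → Finset (Set (ℝ × ℝ))}

lemma Config.no_cover (h : Config X us) {s : Finset (Set (ℝ × ℝ))} (hs : ∀ u ∈ s, IsLn u)
    (hc : s.card ≤ 5) (hX : ∀ B ∈ X, ∃ u ∈ s, B ∈ u) : False := by
  obtain ⟨P, hP⟩ := exists_notMem_lines hs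
  have := h.poised (pr s) (PF_mono hc (pr_mem_PF s)) fun B hB => (pr_eq_zero_iff hs).mpr (hX B hB)
  obtain ⟨u, hu, hu'⟩ := (pr_eq_zero_iff hs).mp (congrFun this P)
  exact hP u hu hu'

lemma Config.false_of_replace (h : Config X us) {A : ℝ × ℝ} (hA : A ∈ X) {u w : Set (ℝ × ℝ)}
    (hu : u ∈ us A) (hw : IsLn w) (hAw : A ∈ w) (huw : ∀ B ∈ X, B ∈ u → B ∈ w) : False := by
  refine h.no_cover (s := insert w ((us A).erase u)) ?_ ?_ fun B hB => ?_
  · intro v hv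
    rcases Finset.mem_insert.mp hv with rfl | hv
    · exact hw
    · exact h.line A hA v (Finset.mem_of_mem_erase hv)
  · refine (Finset.card_insert_le _ _).trans ?_
    rw [Finset.card_erase_of_mem hu, h.five A hA]
  · by_cases hBA : B = A
    · exact ⟨w, Finset.mem_insert_self _ _, hBA ▸ hAw⟩
    · obtain ⟨v, hv, hBv⟩ := h.cover A hA B hB hBA
      by_cases hvu : v = u
      · exact ⟨w, Finset.mem_insert_self _ _, huw B hB (hvu ▸ hBv)⟩
      · exact ⟨v, Finset.mem_insert_of_mem (Finset.mem_erase.mpr ⟨hvu, hv⟩), hBv⟩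

lemma Config.two_le (h : Config X us) {A : ℝ × ℝ} (hA : A ∈ X) {u : Set (ℝ × ℝ)}
    (hu : u ∈ us A) : 2 ≤ (nod X u).card := by
  by_contra! hlt
  obtain ⟨N, hN, hNu⟩ : ∃ N, N ≠ A ∧ ∀ B ∈ X, B ∈ u → B = N := by
    by_cases he : (nod X u).Nonempty
    · obtain ⟨N, hN⟩ := he
      refine ⟨N, fun hNA => h.avoid A hA u hu (hNA ▸ (mem_nod.mp hN).2), fun B hB hBu => ?_⟩
      exact Finset.card_le_one.mp (by omega) B (mem_nod.mpr ⟨hB, hBu⟩) N hN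
    · refine ⟨(A.1 + 1, A.2), fun he => by simpa using congrArg Prod.fst he, fun B hB hBu => ?_⟩
      exact absurd ⟨B, mem_nod.mpr ⟨hB, hBu⟩⟩ he
  exact h.false_of_replace hA hu (isLn_join hN) (right_mem_join _ _)
    fun B hB hBu => hNu B hB hBu ▸ left_mem_join _ _

lemma Config.dep_eq_zero (h : Config X us) {u : Set (ℝ × ℝ)} {S : Finset (ℝ × ℝ)}
    (hS : S ⊆ off X u) {c : ℝ × ℝ → ℝ} (hc : Dep 4 S c) {A : ℝ × ℝ} (hA : A ∈ S)
    (hAu : A ∈ usr X us u) : c A = 0 := by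
  obtain ⟨hAX, hu⟩ := mem_usr.mp hAu
  have hl : ∀ v ∈ (us A).erase u, IsLn v := fun v hv => h.line A hAX v (Finset.mem_of_mem_erase hv)
  have h1 := hc (pr ((us A).erase u)) (by
    have := pr_mem_PF ((us A).erase u)
    rwa [Finset.card_erase_of_mem hu, h.five A hAX] at this)
  rw [Finset.sum_eq_single A] at h1
  · refine (mul_eq_zero.mp h1).resolve_right fun h0 => ?_
    obtain ⟨v, hv, hAv⟩ := (pr_eq_zero_iff hl).mp h0
    exact h.avoid A hAX v (Finset.mem_of_mem_erase hv) hAv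
  · intro B hB hBA
    obtain ⟨hBX, hBu⟩ := mem_off.mp (hS hB)
    obtain ⟨v, hv, hBv⟩ := h.cover A hAX B hBX hBA
    rw [(pr_eq_zero_iff hl).mpr ⟨v, Finset.mem_erase.mpr ⟨fun e => hBu (e ▸ hBv), hv⟩, hBv⟩,
      mul_zero]
  · exact fun h => absurd hA h

lemma Config.peel_fails (h : Config X us) {u : Set (ℝ × ℝ)} {S : Finset (ℝ × ℝ)}
    (hS : S ⊆ off X u) (hcard : 16 ≤ S.card) {A v₁ v₂ v₃ v₄} (hA : A ∈ usr X us u)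
    (hV : (us A).erase u = {v₁, v₂, v₃, v₄})
    (k1 : (nod (S \ usr X us u) v₁).card ≤ 5)
    (k2 : (nod (off (S \ usr X us u) v₁) v₂).card ≤ 4)
    (k3 : (nod (off (off (S \ usr X us u) v₁) v₂) v₃).card ≤ 3)
    (k4 : (nod (off (off (off (S \ usr X us u) v₁) v₂) v₃) v₄).card ≤ 2) : False := by
  obtain ⟨c, ⟨B, hB, hcB⟩, hc⟩ := exists_dep (S := S) (by omega)
  have hz := fun B hB => h.dep_eq_zero hS hc (A := B) hB
  have hB' : B ∈ S \ usr X us u := Finset.mem_sdiff.mpr ⟨hB, fun hu => hcB (hz B hB hu)⟩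
  obtain ⟨hAX, hu⟩ := mem_usr.mp hA
  have hl : ∀ v ∈ (us A).erase u, IsLn v := fun v hv => h.line A hAX v (Finset.mem_of_mem_erase hv)
  refine hcB (Dep.peel_four (hl v₁ (by simp [hV])) (hl v₂ (by simp [hV])) (hl v₃ (by simp [hV]))
    k1 k2 k3 k4 (fun B hB => ?_) (hc.mono_of_zero Finset.sdiff_subset fun B hB hB' => hz B hB ?_)
    B hB')
  · obtain ⟨hBS, hBu⟩ := Finset.mem_sdiff.mp hB
    obtain ⟨hBX, hBu'⟩ := mem_off.mp (hS hBS)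
    obtain ⟨v, hv, hBv⟩ := h.cover A hAX B hBX fun e => hBu (e ▸ hA)
    have : v ∈ (us A).erase u := Finset.mem_erase.mpr ⟨fun e => hBu' (e ▸ hBv), hv⟩
    rw [hV] at this
    simp only [Finset.mem_insert, Finset.mem_singleton] at this
    rcases this with rfl | rfl | rfl | rfl <;> tauto
  · by_contra hn
    exact hB' (Finset.mem_sdiff.mpr ⟨hB, hn⟩)

end Nodes

section Caps
open scoped Classical

variable {X : Finset (ℝ × ℝ)} {us : ℝ × ℝ → Finset (Set (ℝ × ℝ))}

lemma exists_greedy_order {V : Finset (Set (ℝ × ℝ))} (hV : V.card = 4) (K : Finset (ℝ × ℝ)) :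
    ∃ v₁ v₂ v₃ v₄, V = {v₁, v₂, v₃, v₄} ∧ v₁ ≠ v₂ ∧
      (nod (off K v₁) v₂).card ≤ (nod K v₁).card ∧
      (nod (off (off K v₁) v₂) v₃).card ≤ (nod (off K v₁) v₂).card ∧
      (nod (off (off (off K v₁) v₂) v₃) v₄).card ≤ (nod (off (off K v₁) v₂) v₃).card ∧
      (nod K v₁).card + (nod (off K v₁) v₂).card + (nod (off (off K v₁) v₂) v₃).card +
        (nod (off (off (off K v₁) v₂) v₃) v₄).card ≤ K.card := by
  obtain ⟨v₁, h1, m1⟩ := Finset.exists_max_image V (fun v => (nod K v).card)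
    (Finset.card_pos.mp (by omega))
  have c1 := Finset.card_erase_of_mem h1
  obtain ⟨v₂, h2, m2⟩ := Finset.exists_max_image (V.erase v₁) (fun v => (nod (off K v₁) v).card)
    (Finset.card_pos.mp (by omega))
  have c2 := Finset.card_erase_of_mem h2
  obtain ⟨v₃, h3, m3⟩ := Finset.exists_max_image ((V.erase v₁).erase v₂)
    (fun v => (nod (off (off K v₁) v₂) v).card) (Finset.card_pos.mp (by omega))
  have c3 := Finset.card_erase_of_mem h3
  obtain ⟨v₄, h4⟩ := Finset.card_eq_one.mp (show (((V.erase v₁).erase v₂).erase v₃).card = 1 by omega)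
  have h4' : v₄ ∈ ((V.erase v₁).erase v₂).erase v₃ := by rw [h4]; exact Finset.mem_singleton_self _
  have hle : ∀ (S : Finset (ℝ × ℝ)) v w, (nod (off S v) w).card ≤ (nod S w).card := fun S v w =>
    Finset.card_le_card (nod_mono (off_subset S v) w)
  refine ⟨v₁, v₂, v₃, v₄, ?_, (Finset.ne_of_mem_erase h2).symm, ?_, ?_, ?_, ?_⟩
  · rw [← Finset.insert_erase h1, ← Finset.insert_erase h2, ← Finset.insert_erase h3, h4]
  · exact (hle _ _ _).trans (m1 _ (Finset.mem_of_mem_erase h2))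
  · exact (hle _ _ _).trans (m2 _ (Finset.mem_of_mem_erase h3))
  · exact (hle _ _ _).trans (m3 _ (Finset.mem_of_mem_erase h4'))
  · have e1 := card_nod_add_card_off K v₁
    have e2 := card_nod_add_card_off (off K v₁) v₂
    have e3 := card_nod_add_card_off (off (off K v₁) v₂) v₃
    have e4 := card_nod_add_card_off (off (off (off K v₁) v₂) v₃) v₄
    omega

lemma Config.card_erase_us (h : Config X us) {A : ℝ × ℝ} (hA : A ∈ X) {u : Set (ℝ × ℝ)}
    (hu : u ∈ us A) : ((us A).erase u).card = 4 := by
  rw [Finset.card_erase_of_mem hu, h.five A hA]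

lemma Config.usr_subset_off (h : Config X us) (u : Set (ℝ × ℝ)) : usr X us u ⊆ off X u :=
  fun A hA => mem_off.mpr ⟨(mem_usr.mp hA).1, h.avoid A (mem_usr.mp hA).1 u (mem_usr.mp hA).2⟩

lemma Config.exists_isT_of_five (h : Config X us) {u : Set (ℝ × ℝ)} (hu : IsLn u)
    (hk : (nod X u).card = 5) (hn : 5 ≤ (usr X us u).card) : ∃ t, IsT X t ∧ u ∈ t := by
  obtain ⟨A, hA⟩ := Finset.card_pos.mp (show 0 < (usr X us u).card by omega)
  obtain ⟨hAX, hAu⟩ := mem_usr.mp hA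
  have h0 := card_nod_add_card_off X u
  have hcX := h.card
  obtain ⟨v₁, v₂, v₃, v₄, hV, h12, o1, o2, o3, os⟩ :=
    exists_greedy_order (h.card_erase_us hAX hAu) (off X u \ usr X us u)
  have hK := Finset.card_sdiff_add_card_eq_card (h.usr_subset_off u)
  have hln : ∀ v ∈ (us A).erase u, IsLn v ∧ v ≠ u := fun v hv =>
    ⟨h.line A hAX v (Finset.mem_of_mem_erase hv), Finset.ne_of_mem_erase hv⟩
  obtain ⟨l1, n1⟩ := hln v₁ (by simp [hV])
  obtain ⟨l2, n2⟩ := hln v₂ (by simp [hV])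
  have s1 : nod (off X u \ usr X us u) v₁ ⊆ nod (off X u) v₁ := nod_mono Finset.sdiff_subset _
  have s1' : nod (off X u) v₁ ⊆ nod X v₁ := nod_mono (off_subset _ _) _
  have s2 : nod (off (off X u \ usr X us u) v₁) v₂ ⊆ nod (off (off X u) v₁) v₂ := by
    intro B hB
    simp only [mem_nod, mem_off, Finset.mem_sdiff] at hB ⊢
    tauto
  have s2' : nod (off (off X u) v₁) v₂ ⊆ nod X v₂ :=
    nod_mono ((off_subset _ _).trans (off_subset _ _)) _
  have c1 := Finset.card_le_card s1
  have c1' := Finset.card_le_card s1'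
  have c2 := Finset.card_le_card s2
  have c2' := Finset.card_le_card s2'
  have m1 := h.le5 v₁ l1
  have m2 := h.le5 v₂ l2
  have k2 : 5 ≤ (nod (off (off X u \ usr X us u) v₁) v₂).card := by
    by_contra! hlt
    exact h.peel_fails Finset.Subset.rfl (by omega) hA hV (by omega) (by omega) (by omega)
      (by omega)
  have e1 := Finset.eq_of_subset_of_card_le s1' (by omega)
  have e2 := Finset.eq_of_subset_of_card_le s2' (by omega)
  have d1 : ∀ P ∈ X, P ∈ v₁ → P ∉ u := fun P hP hP1 =>
    (mem_off.mp (mem_nod.mp (e1 ▸ mem_nod.mpr ⟨hP, hP1⟩ : P ∈ nod (off X u) v₁)).1).2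
  have d2 : ∀ P ∈ X, P ∈ v₂ → P ∉ u ∧ P ∉ v₁ := fun P hP hP1 => by
    have := mem_nod.mp (e2 ▸ mem_nod.mpr ⟨hP, hP1⟩ : P ∈ nod (off (off X u) v₁) v₂)
    simp only [mem_off] at this
    tauto
  refine ⟨{u, v₁, v₂}, ⟨?_, ?_, ?_, ?_⟩, by simp⟩
  · rw [Finset.card_eq_three]; exact ⟨_, _, _, n1.symm, n2.symm, h12, rfl⟩
  · simp only [Finset.mem_insert, Finset.mem_singleton]; rintro v (rfl | rfl | rfl) <;> assumption
  · simp only [Finset.mem_insert, Finset.mem_singleton]; rintro v (rfl | rfl | rfl) <;> omega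
  · simp only [Finset.mem_insert, Finset.mem_singleton]
    rintro v (rfl | rfl | rfl) w (rfl | rfl | rfl) hvw P hP hPv hPw
    · exact hvw rfl
    · exact d1 P hP hPw hPv
    · exact (d2 P hP hPw).1 hPv
    · exact d1 P hP hPv hPw
    · exact hvw rfl
    · exact (d2 P hP hPw).2 hPv
    · exact (d2 P hP hPv).1 hPw
    · exact (d2 P hP hPv).2 hPw
    · exact hvw rfl

lemma Config.card_usr_le_of_four (h : Config X us) {u : Set (ℝ × ℝ)}
    (hk : (nod X u).card = 4) : (usr X us u).card ≤ 3 := by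
  by_contra! hn
  obtain ⟨A, hA⟩ := Finset.card_pos.mp (show 0 < (usr X us u).card by omega)
  obtain ⟨hAX, hAu⟩ := mem_usr.mp hA
  have h0 := card_nod_add_card_off X u
  have hcX := h.card
  obtain ⟨v₁, v₂, v₃, v₄, hV, h12, o1, o2, o3, os⟩ :=
    exists_greedy_order (h.card_erase_us hAX hAu) (off X u \ usr X us u)
  have hK := Finset.card_sdiff_add_card_eq_card (h.usr_subset_off u)
  have hln : ∀ v ∈ (us A).erase u, IsLn v := fun v hv =>
    h.line A hAX v (Finset.mem_of_mem_erase hv)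
  have m : ∀ v ∈ (us A).erase u, ∀ S, S ⊆ X → (nod S v).card ≤ 5 := fun v hv S hS =>
    (Finset.card_le_card (nod_mono hS v)).trans (h.le5 v (hln v hv))
  have m1 := m v₁ (by simp [hV]) (off X u \ usr X us u)
    (Finset.sdiff_subset.trans (off_subset _ _))
  have m2 := m v₂ (by simp [hV]) (off (off X u \ usr X us u) v₁)
    ((off_subset _ _).trans (Finset.sdiff_subset.trans (off_subset _ _)))
  set K := off X u \ usr X us u with hKd
  have hB : ∀ B ∈ K, ((off X u).erase B) \ usr X us u = K.erase B := fun B hB => by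
    ext P; simp only [hKd, Finset.mem_erase, Finset.mem_sdiff]; tauto
  have hpf : ∀ B ∈ K, ¬ ((nod (K.erase B) v₁).card ≤ 5 ∧ (nod (off (K.erase B) v₁) v₂).card ≤ 4 ∧
      (nod (off (off (K.erase B) v₁) v₂) v₃).card ≤ 3 ∧
      (nod (off (off (off (K.erase B) v₁) v₂) v₃) v₄).card ≤ 2) := by
    rintro B hBK ⟨k1, k2, k3, k4⟩
    rw [← hB B hBK] at k1 k2 k3 k4
    refine h.peel_fails (Finset.erase_subset _ _) ?_ hA hV k1 k2 k3 k4
    rw [Finset.card_erase_of_mem (Finset.mem_sdiff.mp hBK).1]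
    omega
  have eo : ∀ (S : Finset (ℝ × ℝ)) B v, off (S.erase B) v = (off S v).erase B := fun S B v => by
    ext P; simp only [mem_off, Finset.mem_erase]; tauto
  have en : ∀ (S : Finset (ℝ × ℝ)) B v, nod (S.erase B) v = (nod S v).erase B := fun S B v => by
    ext P; simp only [mem_nod, Finset.mem_erase]; tauto
  simp only [eo, en] at hpf
  have hle : ∀ (S : Finset (ℝ × ℝ)) B, (S.erase B).card ≤ S.card := fun S B => Finset.card_erase_le
  have hsub : ∀ S ⊆ K, ∀ v, nod S v ⊆ K := fun S hS v => (nod_subset S v).trans hS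
  have r1 : off K v₁ ⊆ K := off_subset _ _
  have r2 : off (off K v₁) v₂ ⊆ K := (off_subset _ _).trans r1
  have r3 : off (off (off K v₁) v₂) v₃ ⊆ K := (off_subset _ _).trans r2
  have hex : ∀ S : Finset (ℝ × ℝ), 0 < S.card → ∃ B ∈ S, (S.erase B).card = S.card - 1 :=
    fun S hS => by
      obtain ⟨B, hB⟩ := Finset.card_pos.mp hS
      exact ⟨B, hB, Finset.card_erase_of_mem hB⟩
  by_cases c2 : 5 ≤ (nod (off K v₁) v₂).card
  · obtain ⟨B, hB, hBc⟩ := hex _ (show 0 < (nod (off K v₁) v₂).card by omega)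
    refine hpf B (hsub _ r1 _ hB) ⟨?_, ?_, ?_, ?_⟩ <;> first | omega | (refine (hle _ _).trans ?_; omega)
  by_cases c3 : 4 ≤ (nod (off (off K v₁) v₂) v₃).card
  · obtain ⟨B, hB, hBc⟩ := hex _ (show 0 < (nod (off (off K v₁) v₂) v₃).card by omega)
    refine hpf B (hsub _ r2 _ hB) ⟨?_, ?_, ?_, ?_⟩ <;> first | omega | (refine (hle _ _).trans ?_; omega)
  by_cases c4 : 3 ≤ (nod (off (off (off K v₁) v₂) v₃) v₄).card
  · obtain ⟨B, hB, hBc⟩ := hex _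
      (show 0 < (nod (off (off (off K v₁) v₂) v₃) v₄).card by omega)
    refine hpf B (hsub _ r3 _ hB) ⟨?_, ?_, ?_, ?_⟩ <;> first | omega | (refine (hle _ _).trans ?_; omega)
  · exact h.peel_fails Finset.Subset.rfl (by omega) hA hV m1 (Nat.le_of_not_lt c2)
      (Nat.le_of_not_lt c3) (Nat.le_of_not_lt c4)

lemma aff_eq_zero_of_two_lines {s : Finset (Set (ℝ × ℝ))} (hs : ∀ u ∈ s, IsLn u) {v : Fin 3 → ℝ}
    {w w' : Set (ℝ × ℝ)} (hw : IsLn w) (hw' : IsLn w') (hww : w ≠ w') (hws : w ∉ s) (hws' : w' ∉ s)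
    (h : ∀ P, P ∈ w ∨ P ∈ w' → pr s P * aff v P = 0) : v = 0 := by
  have h' : ∀ P, P ∈ w ∨ P ∈ w' → (∃ u ∈ s, P ∈ u) ∨ aff v P = 0 := fun P hP =>
    (mul_eq_zero.mp (h P hP)).imp (pr_eq_zero_iff hs).mp id
  by_cases hv : v 0 ≠ 0 ∨ v 1 ≠ 0
  · exfalso
    have hz : IsLn {P | aff v P = 0} := ⟨v, hv, rfl⟩
    have hins : ∀ u ∈ insert {P | aff v P = 0} s, IsLn u := fun u hu => by
      rcases Finset.mem_insert.mp hu with rfl | hu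
      exacts [hz, hs u hu]
    have key : ∀ w, IsLn w → w ∉ s → (∀ P ∈ w, (∃ u ∈ s, P ∈ u) ∨ aff v P = 0) →
        w = {P | aff v P = 0} := fun w hw hws hP => by
      refine (Finset.mem_insert.mp (hw.mem_of_forall_mem hins fun P hPw => ?_)).resolve_right hws
      rcases hP P hPw with ⟨u, hu, hPu⟩ | h0
      · exact ⟨u, Finset.mem_insert_of_mem hu, hPu⟩
      · exact ⟨_, Finset.mem_insert_self _ _, h0⟩
    exact hww ((key w hw hws fun P hP => h' P (.inl hP)).trans
      (key w' hw' hws' fun P hP => h' P (.inr hP)).symm)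
  · push Not at hv
    obtain ⟨P, hP, hPs⟩ := exists_notMem_lines_on hs hw hws
    rcases h' P (.inl hP) with ⟨u, hu, hPu⟩ | h0
    · exact absurd hPu (hPs u hu)
    · simp only [aff, hv.1, hv.2, zero_mul, zero_add] at h0
      ext i; fin_cases i
      exacts [hv.1, hv.2, h0]

lemma isT_of_card {t : Finset (Set (ℝ × ℝ))} (ht : t.card = 3) (hl : ∀ u ∈ t, IsLn u)
    (h5 : ∀ u ∈ t, (nod X u).card ≤ 5) (hc : 15 ≤ (t.biUnion (nod X)).card) : IsT X t := by
  obtain ⟨a, b, c, hab, hac, hbc, rfl⟩ := Finset.card_eq_three.mp ht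
  simp only [Finset.biUnion_insert, Finset.singleton_biUnion] at hc
  have ha := h5 a (by simp)
  have hb := h5 b (by simp)
  have hcc := h5 c (by simp)
  have e1 := Finset.card_union_add_card_inter (nod X b) (nod X c)
  have e2 := Finset.card_union_add_card_inter (nod X a) (nod X b ∪ nod X c)
  have z1 := Finset.card_eq_zero.mp (show (nod X b ∩ nod X c).card = 0 by omega)
  have z2 := Finset.card_eq_zero.mp (show (nod X a ∩ (nod X b ∪ nod X c)).card = 0 by omega)
  have n1 : ∀ P ∈ X, ¬ (P ∈ b ∧ P ∈ c) := fun P hP ⟨h1, h2⟩ =>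
    Finset.eq_empty_iff_forall_notMem.mp z1 P (by simp only [Finset.mem_inter, mem_nod]; tauto)
  have n2 : ∀ P ∈ X, ¬ (P ∈ a ∧ (P ∈ b ∨ P ∈ c)) := fun P hP ⟨h1, h2⟩ =>
    Finset.eq_empty_iff_forall_notMem.mp z2 P (by simp only [Finset.mem_inter, Finset.mem_union, mem_nod]; tauto)
  refine ⟨ht, hl, ?_, ?_⟩
  · simp only [Finset.mem_insert, Finset.mem_singleton]; rintro v (rfl | rfl | rfl) <;> omega
  · simp only [Finset.mem_insert, Finset.mem_singleton]
    rintro v (rfl | rfl | rfl) w (rfl | rfl | rfl) hvw P hP hPv hPw <;>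
      first | exact hvw rfl | (have := n1 P hP; have := n2 P hP; tauto)

lemma exists_affine_syzygy (f g : ℝ × ℝ → ℝ) {E : Finset (ℝ × ℝ)} (hE : E.card ≤ 5) :
    ∃ s t : Fin 3 → ℝ, (s ≠ 0 ∨ t ≠ 0) ∧ ∀ P ∈ E, f P * aff s P + g P * aff t P = 0 := by
  obtain ⟨c, hc, hc0⟩ := exists_nontrivial_solution (ι := Bool × Fin 3) (κ := E)
    (by simp; omega) (fun P i => cond i.1 (f P.1) (g P.1) * ![P.1.1, P.1.2, 1] i.2)
  refine ⟨fun i => c (true, i), fun i => c (false, i), ?_, fun P hP => ?_⟩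
  · by_contra! hn
    refine hc (funext fun ⟨i, j⟩ => ?_)
    cases i
    · exact congrFun hn.2 j
    · exact congrFun hn.1 j
  · have := hc0 ⟨P, hP⟩
    rw [Fintype.sum_prod_type] at this
    simp only [Fintype.sum_bool, Fin.sum_univ_three, cond_true, cond_false, Matrix.cons_val]
      at this
    rw [← this]
    simp only [aff]; ring

lemma Config.two_users (h : Config X us) {u : Set (ℝ × ℝ)} (hk : (nod X u).card ≤ 3)
    {A B : ℝ × ℝ} (hAB : A ≠ B) (hA : A ∈ usr X us u) (hB : B ∈ usr X us u) :
    (nod X u).card = 3 ∧ ∃ t, IsT X t ∧ t ⊆ us A ∧ t ⊆ us B := by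
  obtain ⟨hAX, hAu⟩ := mem_usr.mp hA
  obtain ⟨hBX, hBu⟩ := mem_usr.mp hB
  set V := (us A).erase u with hV
  set W := (us B).erase u with hW
  have hVc : V.card = 4 := h.card_erase_us hAX hAu
  have hWc : W.card = 4 := h.card_erase_us hBX hBu
  have lV : ∀ v ∈ V, IsLn v := fun v hv => h.line A hAX v (Finset.mem_of_mem_erase hv)
  have lW : ∀ v ∈ W, IsLn v := fun v hv => h.line B hBX v (Finset.mem_of_mem_erase hv)
  have zero : ∀ P ∈ X, P ∉ u → ∀ C ∈ X, u ∈ us C → P ≠ C → ∃ v ∈ (us C).erase u, P ∈ v :=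
    fun P hP hPu C hC huC hPC => by
      obtain ⟨v, hv, hPv⟩ := h.cover C hC P hP hPC
      exact ⟨v, Finset.mem_erase.mpr ⟨fun e => hPu (e ▸ hPv), hv⟩, hPv⟩
  have e1 := Finset.card_sdiff_add_card_inter V W
  have e2 := Finset.card_sdiff_add_card_inter W V
  rw [Finset.inter_comm W V] at e2
  have hVW : 3 ≤ (V ∩ W).card := by
    by_contra! hlt
    obtain ⟨v, hv, v', hv', hvv⟩ := Finset.one_lt_card.mp (show 1 < (V \ W).card by omega)
    obtain ⟨w, hw, w', hw', hww⟩ := Finset.one_lt_card.mp (show 1 < (W \ V).card by omega)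
    rw [Finset.mem_sdiff] at hv hv' hw hw'
    have hEc : (insert A (insert B (nod X u))).card ≤ 5 := by
      have := Finset.card_insert_le A (insert B (nod X u))
      have := Finset.card_insert_le B (nod X u)
      omega
    obtain ⟨s, t, hst, hF⟩ := exists_affine_syzygy (pr V) (pr W) hEc
    have hpr : ∀ V, V.card = 4 → pr V ∈ PF 4 := fun V hV => by
      have := pr_mem_PF V
      rwa [hV] at this
    have hPF : pr V * aff s + pr W * aff t = 0 := by
      refine h.poised _ (add_mem ?_ ?_) fun P hP => ?_
      · exact mul_mem_PF (m := 4) (n := 1) (hpr V hVc) (aff_mem_PF s)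
      · exact mul_mem_PF (m := 4) (n := 1) (hpr W hWc) (aff_mem_PF t)
      · simp only [Pi.add_apply, Pi.mul_apply]
        by_cases hPE : P ∈ insert A (insert B (nod X u))
        · exact hF P hPE
        · simp only [Finset.mem_insert, mem_nod, not_or] at hPE
          have hPu : P ∉ u := fun hPu => hPE.2.2 ⟨hP, hPu⟩
          rw [(pr_eq_zero_iff lV).mpr (zero P hP hPu A hAX hAu hPE.1),
            (pr_eq_zero_iff lW).mpr (zero P hP hPu B hBX hBu hPE.2.1)]
          ring
    have hall : ∀ P, pr V P * aff s P + pr W P * aff t P = 0 := fun P => congrFun hPF P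
    have ht0 : t = 0 := aff_eq_zero_of_two_lines lW (lV v hv.1) (lV v' hv'.1) hvv hv.2 hv'.2
      fun P hP => by
        have : pr V P = 0 := (pr_eq_zero_iff lV).mpr
          (hP.elim (fun hP => ⟨v, hv.1, hP⟩) fun hP => ⟨v', hv'.1, hP⟩)
        simpa [this] using hall P
    have hs0 : s = 0 := aff_eq_zero_of_two_lines lV (lW w hw.1) (lW w' hw'.1) hww hw.2 hw'.2
      fun P hP => by
        have : pr W P = 0 := (pr_eq_zero_iff lW).mpr
          (hP.elim (fun hP => ⟨w, hw.1, hP⟩) fun hP => ⟨w', hw'.1, hP⟩)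
        simpa [this] using hall P
    exact hst.elim (fun h => h hs0) (fun h => h ht0)
  obtain ⟨t, htVW, htc⟩ := Finset.exists_subset_card_eq hVW
  have htV : t ⊆ V := htVW.trans Finset.inter_subset_left
  have htW : t ⊆ W := htVW.trans Finset.inter_subset_right
  obtain ⟨v, hv⟩ := Finset.card_eq_one.mp
    (show (V \ t).card = 1 by rw [Finset.card_sdiff_of_subset htV]; omega)
  obtain ⟨w, hw⟩ := Finset.card_eq_one.mp
    (show (W \ t).card = 1 by rw [Finset.card_sdiff_of_subset htW]; omega)
  have hvV : v ∈ V := (Finset.mem_sdiff.mp (hv ▸ Finset.mem_singleton_self v)).1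
  have hwW : w ∈ W := (Finset.mem_sdiff.mp (hw ▸ Finset.mem_singleton_self w)).1
  have mV : ∀ x ∈ V, x ∈ t ∨ x = v := fun x hx => by
    by_cases hxt : x ∈ t
    · exact .inl hxt
    · exact .inr (by simpa [hv] using (Finset.mem_sdiff.mpr ⟨hx, hxt⟩ : x ∈ V \ t))
  have mW : ∀ x ∈ W, x ∈ t ∨ x = w := fun x hx => by
    by_cases hxt : x ∈ t
    · exact .inl hxt
    · exact .inr (by simpa [hw] using (Finset.mem_sdiff.mpr ⟨hx, hxt⟩ : x ∈ W \ t))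
  have hvw : v ≠ w := by
    rintro rfl
    obtain ⟨x, hx, hAx⟩ := zero A hAX (h.avoid A hAX u hAu) B hBX hBu hAB
    refine h.avoid A hAX x ?_ hAx
    rcases mW x hx with hx | rfl
    · exact Finset.mem_of_mem_erase (htV hx)
    · exact Finset.mem_of_mem_erase hvV
  set I := ((off X u).erase A).erase B with hI
  have hIc : 19 - (nod X u).card ≤ I.card := by
    have h1 := card_nod_add_card_off X u
    have h4 := h.card
    rw [hI, Finset.card_erase_of_mem (Finset.mem_erase.mpr ⟨hAB.symm, h.usr_subset_off u hB⟩),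
      Finset.card_erase_of_mem (h.usr_subset_off u hA)]
    omega
  have hIsub : (I \ t.biUnion (nod X)).card ≤ 1 := by
    have key : ∀ P ∈ I \ t.biUnion (nod X), P ∈ v ∧ P ∈ w := fun P hP => by
      obtain ⟨hPI, hPt⟩ := Finset.mem_sdiff.mp hP
      simp only [hI, Finset.mem_erase, mem_off] at hPI
      obtain ⟨hPB, hPA, hPX, hPu⟩ := hPI
      have hPt' : ∀ x ∈ t, P ∉ x := fun x hx hPx =>
        hPt (Finset.mem_biUnion.mpr ⟨x, hx, mem_nod.mpr ⟨hPX, hPx⟩⟩)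
      obtain ⟨x, hx, hPx⟩ := zero P hPX hPu A hAX hAu hPA
      obtain ⟨y, hy, hPy⟩ := zero P hPX hPu B hBX hBu hPB
      exact ⟨(mV x hx).elim (fun hx => absurd hPx (hPt' x hx)) (fun e => e ▸ hPx),
        (mW y hy).elim (fun hy => absurd hPy (hPt' y hy)) (fun e => e ▸ hPy)⟩
    refine Finset.card_le_one.mpr fun P hP Q hQ => ?_
    by_contra hPQ
    exact hvw ((lV v hvV).eq_of_mem (lW w hwW) hPQ (key P hP).1 (key Q hQ).1 (key P hP).2
      (key Q hQ).2)
  have h5 : ∀ x ∈ t, (nod X x).card ≤ 5 := fun x hx => h.le5 x (lV x (htV hx))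
  have hbi : I.card ≤ (t.biUnion (nod X)).card + 1 := by
    have := Finset.card_le_card_sdiff_add_card (t := t.biUnion (nod X)) (s := I)
    omega
  have h15 : (t.biUnion (nod X)).card ≤ 15 := by
    have := Finset.card_biUnion_le_card_mul t (nod X) 5 h5
    omega
  refine ⟨by omega, t, isT_of_card htc (fun x hx => lV x (htV hx)) h5 (by omega), ?_, ?_⟩
  · exact fun x hx => Finset.mem_of_mem_erase (htV hx)
  · exact fun x hx => Finset.mem_of_mem_erase (htW hx)

end Caps

section Triples
open scoped Classical

variable {X : Finset (ℝ × ℝ)} {us : ℝ × ℝ → Finset (Set (ℝ × ℝ))} {t : Finset (Set (ℝ × ℝ))}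

/-- The nodes on none of the lines of `t`. -/
noncomputable def rest (X : Finset (ℝ × ℝ)) (t : Finset (Set (ℝ × ℝ))) : Finset (ℝ × ℝ) :=
  X.filter fun P => ∀ u ∈ t, P ∉ u

lemma mem_rest {P : ℝ × ℝ} : P ∈ rest X t ↔ P ∈ X ∧ ∀ u ∈ t, P ∉ u := Finset.mem_filter

lemma rest_subset : rest X t ⊆ X := Finset.filter_subset _ _

lemma exists_line_of_notMem_rest {P : ℝ × ℝ} (hP : P ∈ X) (h : P ∉ rest X t) :
    ∃ u ∈ t, P ∈ u := by
  by_contra! hn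
  exact h (mem_rest.mpr ⟨hP, hn⟩)

lemma IsT.card_rest (ht : IsT X t) : (rest X t).card + 15 = X.card := by
  have h1 : (t.biUnion (nod X)).card = 15 := by
    rw [Finset.card_biUnion, Finset.sum_congr rfl ht.five]
    · simp [ht.card]
    · intro u hu v hv huv
      exact Finset.disjoint_left.mpr fun P hP hP' =>
        ht.disj u hu v hv huv P (mem_nod.mp hP).1 (mem_nod.mp hP).2 (mem_nod.mp hP').2
  have h2 : X \ t.biUnion (nod X) = rest X t := by
    ext P
    simp only [Finset.mem_sdiff, Finset.mem_biUnion, mem_nod, mem_rest, not_exists, not_and]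
    exact and_congr_right fun hP => forall₂_congr fun u _ => by simp [hP]
  have h3 : t.biUnion (nod X) ⊆ X := Finset.biUnion_subset.mpr fun u _ => nod_subset X u
  rw [← h2, ← h1, Finset.card_sdiff_add_card_eq_card h3]

lemma exists_conic {E : Finset (ℝ × ℝ)} (hE : E.card ≤ 5) :
    ∃ q ∈ PF 2, q ≠ 0 ∧ ∀ P ∈ E, q P = 0 := by
  obtain ⟨c, hc, hc0⟩ := exists_nontrivial_solution (ι := Fin 6) (κ := E)
    (by simp; omega) (fun P => ![1, P.1.1, P.1.2, P.1.1 ^ 2, P.1.1 * P.1.2, P.1.2 ^ 2])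
  have hm : ∀ i j, i + j ≤ 2 → (fun P : ℝ × ℝ => P.1 ^ i * P.2 ^ j) ∈ PF 2 := fun i j hij =>
    Submodule.subset_span ⟨i, j, hij, rfl⟩
  have hs : ∀ (a : ℝ) i j, i + j ≤ 2 → (a • fun P : ℝ × ℝ => P.1 ^ i * P.2 ^ j) ∈ PF 2 :=
    fun a i j hij => Submodule.smul_mem _ _ (hm i j hij)
  refine ⟨_, add_mem (add_mem (add_mem (add_mem (add_mem (hs (c 0) 0 0 (by omega))
    (hs (c 1) 1 0 (by omega))) (hs (c 2) 0 1 (by omega))) (hs (c 3) 2 0 (by omega)))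
    (hs (c 4) 1 1 (by omega))) (hs (c 5) 0 2 (by omega)), fun h0 => hc ?_, fun P hP => ?_⟩
  · have e : ∀ x y : ℝ, c 0 + c 1 * x + c 2 * y + c 3 * x ^ 2 + c 4 * (x * y) + c 5 * y ^ 2 = 0 :=
      fun x y => by
        have := congrFun h0 (x, y)
        simpa using this
    have e1 := e 0 0
    have e2 := e 1 0
    have e3 := e (-1) 0
    have e4 := e 0 1
    have e5 := e 0 (-1)
    have e6 := e 1 1
    ext i
    fin_cases i <;> simp <;> linarith
  · have := hc0 ⟨P, hP⟩
    simp only [Fin.sum_univ_six, Matrix.cons_val] at this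
    simp only [Pi.add_apply, Pi.smul_apply, smul_eq_mul]
    rw [← this]; ring

lemma pr_ne_zero {s : Finset (Set (ℝ × ℝ))} (hs : ∀ u ∈ s, IsLn u) : pr s ≠ 0 := by
  obtain ⟨P, hP⟩ := exists_notMem_lines hs
  intro h0
  obtain ⟨u, hu, hPu⟩ := (pr_eq_zero_iff hs).mp (congrFun h0 P)
  exact hP u hu hPu

lemma Config.mem_us_of_vanish (h : Config X us) {Z : ℝ × ℝ} (hZ : Z ∈ X) {f : ℝ × ℝ → ℝ}
    (hf : f ∈ PF 5) (hf0 : f ≠ 0) (hfX : ∀ B ∈ X, B ≠ Z → f B = 0) {w : Set (ℝ × ℝ)}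
    (hw : IsLn w) (hfw : ∀ P ∈ w, f P = 0) : w ∈ us Z := by
  have hr : pr (us Z) ∈ PF 5 := h.five Z hZ ▸ pr_mem_PF (us Z)
  have hl := h.line Z hZ
  have hrZ : pr (us Z) Z ≠ 0 := fun h0 => by
    obtain ⟨u, hu, hZu⟩ := (pr_eq_zero_iff hl).mp h0
    exact h.avoid Z hZ u hu hZu
  have hF := h.poised (pr (us Z) Z • f - f Z • pr (us Z))
    (sub_mem (Submodule.smul_mem _ _ hf) (Submodule.smul_mem _ _ hr)) fun B hB => by
      by_cases hBZ : B = Z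
      · subst hBZ; simp only [Pi.sub_apply, Pi.smul_apply, smul_eq_mul]; ring
      · simp [hfX B hB hBZ, (pr_eq_zero_iff hl).mpr (h.cover Z hZ B hB hBZ)]
  have hF' : ∀ P, pr (us Z) Z * f P = f Z * pr (us Z) P := fun P => by
    have := congrFun hF P
    simp only [Pi.sub_apply, Pi.smul_apply, smul_eq_mul, Pi.zero_apply] at this
    linarith
  have hfZ : f Z ≠ 0 := fun h0 => hf0 (funext fun P => by
    have := hF' P
    rw [h0, zero_mul, mul_eq_zero] at this
    exact this.resolve_left hrZ)
  refine hw.mem_of_forall_mem hl fun P hP => (pr_eq_zero_iff hl).mp ?_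
  have := hF' P
  rw [hfw P hP, mul_zero, eq_comm, mul_eq_zero] at this
  exact this.resolve_left hfZ

lemma Config.card_rest (h : Config X us) (ht : IsT X t) : (rest X t).card = 6 := by
  have := ht.card_rest
  have := h.card
  omega

lemma Config.subset_us (h : Config X us) (ht : IsT X t) {Z : ℝ × ℝ} (hZ : Z ∈ rest X t) :
    t ⊆ us Z := by
  intro w hw
  obtain ⟨q, hq, hq0, hqE⟩ := exists_conic (E := (rest X t).erase Z) (by
    rw [Finset.card_erase_of_mem hZ, h.card_rest ht])
  have hp : pr t ∈ PF 3 := ht.card ▸ pr_mem_PF t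
  refine h.mem_us_of_vanish (rest_subset hZ) (mul_mem_PF (m := 3) (n := 2) hp hq) (fun h0 => ?_) (fun B hB hBZ => ?_)
    (ht.line w hw) fun P hP => ?_
  · exact (eq_zero_or_eq_zero_of_PF hp hq h0).elim (pr_ne_zero ht.line) hq0
  · by_cases hBt : B ∈ rest X t
    · rw [Pi.mul_apply, hqE B (Finset.mem_erase.mpr ⟨hBZ, hBt⟩), mul_zero]
    · rw [Pi.mul_apply, (pr_eq_zero_iff ht.line).mpr (exists_line_of_notMem_rest hB hBt), zero_mul]
  · rw [Pi.mul_apply, (pr_eq_zero_iff ht.line).mpr ⟨w, hw, hP⟩, zero_mul]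

lemma Config.card_sdiff_of_notMem (h : Config X us) (ht : IsT X t) {D : ℝ × ℝ} (hD : D ∈ X)
    {l : Set (ℝ × ℝ)} (hl : l ∈ t) (hlD : l ∉ us D) :
    ((nod X l).erase D).card ≤ (us D \ t).card := by
  refine card_le_card_of_cover (fun u hu => h.line D hD u (Finset.mem_sdiff.mp hu).1)
    (ht.line l hl) (fun hn => (Finset.mem_sdiff.mp hn).2 hl)
    (fun P hP => (mem_nod.mp (Finset.mem_of_mem_erase hP)).2) fun P hP => ?_
  obtain ⟨hPD, hP⟩ := Finset.mem_erase.mp hP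
  obtain ⟨hPX, hPl⟩ := mem_nod.mp hP
  obtain ⟨u, hu, hPu⟩ := h.cover D hD P hPX hPD
  refine ⟨u, Finset.mem_sdiff.mpr ⟨hu, fun hut => ?_⟩, hPu⟩
  exact ht.disj l hl u hut (fun e => hlD (e ▸ hu)) P hPX hPl hPu

lemma Config.disjoint_us (h : Config X us) (ht : IsT X t) {D : ℝ × ℝ} (hD : D ∈ X)
    {l : Set (ℝ × ℝ)} (hl : l ∈ t) (hDl : D ∈ l) : ∀ u ∈ us D, u ∉ t := by
  intro u hu hut
  have hlD : l ∉ us D := fun hn => h.avoid D hD l hn hDl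
  have h1 := h.card_sdiff_of_notMem ht hD hl hlD
  rw [Finset.card_erase_of_mem (mem_nod.mpr ⟨hD, hDl⟩), ht.five l hl] at h1
  have h2 := Finset.card_sdiff_add_card_inter (us D) t
  have h5 := h.five D hD
  obtain ⟨v, hv, hvl, hvu⟩ : ∃ v ∈ t, v ≠ l ∧ v ≠ u := by
    have : (({l, u} : Finset (Set (ℝ × ℝ)))).card < t.card := by
      have := ht.card
      have := Finset.card_le_two (a := l) (b := u)
      omega
    obtain ⟨v, hv, hvn⟩ := Finset.exists_mem_notMem_of_card_lt_card this
    simp only [Finset.mem_insert, Finset.mem_singleton, not_or] at hvn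
    exact ⟨v, hv, hvn⟩
  have hui : u ∈ us D ∩ t := Finset.mem_inter.mpr ⟨hu, hut⟩
  by_cases hvD : v ∈ us D
  · have := Finset.one_lt_card.mpr ⟨u, hui, v, Finset.mem_inter.mpr ⟨hvD, hv⟩, hvu.symm⟩
    omega
  · have h3 := h.card_sdiff_of_notMem ht hD hv hvD
    rw [Finset.erase_eq_of_notMem fun hn => ht.disj l hl v hv hvl.symm D hD hDl (mem_nod.mp hn).2,
      ht.five v hv] at h3
    have := Finset.card_pos.mpr ⟨u, hui⟩
    omega

lemma Config.exists_mem_of_mem_us (h : Config X us) (ht : IsT X t) {D : ℝ × ℝ} (hD : D ∈ X)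
    {l l' : Set (ℝ × ℝ)} (hl : l ∈ t) (hDl : D ∈ l) (hl' : l' ∈ t) (hll : l' ≠ l)
    {u : Set (ℝ × ℝ)} (hu : u ∈ us D) : ∃ P ∈ X, P ∈ l' ∧ P ∈ u := by
  by_contra! hn
  have := card_le_card_of_cover (s := (us D).erase u)
    (fun v hv => h.line D hD v (Finset.mem_of_mem_erase hv)) (ht.line l' hl')
    (fun hv => h.disjoint_us ht hD hl hDl l' (Finset.mem_of_mem_erase hv) hl') (S := nod X l')
    (fun P hP => (mem_nod.mp hP).2) fun P hP => by
      obtain ⟨hPX, hPl⟩ := mem_nod.mp hP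
      obtain ⟨v, hv, hPv⟩ := h.cover D hD P hPX fun e =>
        ht.disj l hl l' hl' hll.symm D hD hDl (e ▸ hPl)
      exact ⟨v, Finset.mem_erase.mpr ⟨fun e => hn P hPX hPl (e ▸ hPv), hv⟩, hPv⟩
  rw [h.card_erase_us hD hu, ht.five l' hl'] at this
  omega

lemma Config.usr_eq_rest (h : Config X us) (ht : IsT X t) {l : Set (ℝ × ℝ)} (hl : l ∈ t) :
    usr X us l = rest X t := by
  ext P
  rw [mem_usr]
  refine ⟨fun ⟨hP, hPl⟩ => ?_, fun hP => ⟨rest_subset hP, h.subset_us ht hP hl⟩⟩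
  by_contra hn
  obtain ⟨v, hv, hPv⟩ := exists_line_of_notMem_rest hP hn
  exact h.disjoint_us ht hP hv hPv l hPl hl

lemma IsT.card_nod_sdiff_le (ht : IsT X t) {u : Set (ℝ × ℝ)} (hu : IsLn u) (hut : u ∉ t) :
    (nod (X \ rest X t) u).card ≤ 3 := by
  rw [← ht.card]
  refine card_le_card_of_cover ht.line hu hut (fun P hP => (mem_nod.mp hP).2) fun P hP => ?_
  obtain ⟨hP, -⟩ := mem_nod.mp hP
  exact exists_line_of_notMem_rest (Finset.mem_sdiff.mp hP).1 (Finset.mem_sdiff.mp hP).2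

lemma Config.not_two_lines (h : Config X us) (ht : IsT X t) {u v : Set (ℝ × ℝ)} (hu : IsLn u)
    (hv : IsLn v) (hY : ∀ P ∈ rest X t, P ∈ u ∨ P ∈ v) : False := by
  refine h.no_cover (s := insert u (insert v t)) ?_ ?_ fun B hB => ?_
  · simp only [Finset.mem_insert]
    rintro w (rfl | rfl | hw)
    exacts [hu, hv, ht.line w hw]
  · have := Finset.card_insert_le u (insert v t)
    have := Finset.card_insert_le v t
    have := ht.card
    omega
  · by_cases hBt : B ∈ rest X t
    · exact (hY B hBt).elim (fun h => ⟨u, by simp, h⟩) fun h => ⟨v, by simp, h⟩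
    · obtain ⟨w, hw, hBw⟩ := exists_line_of_notMem_rest hB hBt
      exact ⟨w, by simp [hw], hBw⟩

lemma Config.exists_two_lines (h : Config X us) (ht : IsT X t) {Z : ℝ × ℝ}
    (hZ : Z ∈ rest X t) : ∃ u v, us Z = insert u (insert v t) ∧ IsLn u ∧ IsLn v ∧ Z ∉ u ∧ Z ∉ v ∧
      ∀ P ∈ rest X t, P ≠ Z → P ∈ u ∨ P ∈ v := by
  have hZX := rest_subset hZ
  have hsub := h.subset_us ht hZ
  obtain ⟨u, v, -, huv⟩ := Finset.card_eq_two.mp (show (us Z \ t).card = 2 by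
    rw [Finset.card_sdiff_of_subset hsub, h.five Z hZX, ht.card])
  have hus : us Z = insert u (insert v t) := by
    rw [← Finset.sdiff_union_of_subset hsub, huv, Finset.insert_union, Finset.singleton_union]
  refine ⟨u, v, hus, h.line Z hZX u (by simp [hus]), h.line Z hZX v (by simp [hus]),
    h.avoid Z hZX u (by simp [hus]), h.avoid Z hZX v (by simp [hus]), fun P hP hPZ => ?_⟩
  obtain ⟨w, hw, hPw⟩ := h.cover Z hZX P (rest_subset hP) hPZ
  simp only [hus, Finset.mem_insert] at hw
  rcases hw with rfl | rfl | hw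
  · exact .inl hPw
  · exact .inr hPw
  · exact absurd hPw ((mem_rest.mp hP).2 w hw)

lemma Config.card_nod_rest_le (h : Config X us) (ht : IsT X t) {u : Set (ℝ × ℝ)} (hu : IsLn u) :
    (nod (rest X t) u).card ≤ 3 := by
  by_contra! hlt
  have h1 := card_nod_add_card_off (rest X t) u
  rw [h.card_rest ht] at h1
  obtain ⟨v, hv, hvo⟩ : ∃ v, IsLn v ∧ ∀ P ∈ off (rest X t) u, P ∈ v := by
    rcases Nat.lt_or_ge 1 (off (rest X t) u).card with h2 | h2
    · obtain ⟨P, Q, hPQ, hE⟩ := Finset.card_eq_two.mp (show (off (rest X t) u).card = 2 by omega)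
      refine ⟨join P Q, isLn_join hPQ, fun R hR => ?_⟩
      rw [hE, Finset.mem_insert, Finset.mem_singleton] at hR
      rcases hR with rfl | rfl
      exacts [left_mem_join _ _, right_mem_join _ _]
    · rcases (off (rest X t) u).eq_empty_or_nonempty with h3 | ⟨P, hP⟩
      · exact ⟨u, hu, fun R hR => absurd hR (by simp [h3])⟩
      · refine ⟨join P (P.1 + 1, P.2), isLn_join fun e => by simpa using congrArg Prod.fst e,
          fun R hR => ?_⟩
        rw [Finset.card_le_one.mp h2 R hR P hP]
        exact left_mem_join _ _
  refine h.not_two_lines ht hu hv fun P hP => ?_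
  by_cases hPu : P ∈ u
  · exact .inl hPu
  · exact .inr (hvo P (mem_off.mpr ⟨hP, hPu⟩))

lemma Config.mem_us_of_three (h : Config X us) (ht : IsT X t) {u : Set (ℝ × ℝ)} (hu : IsLn u)
    (h3 : 3 ≤ (nod (rest X t) u).card) {Z : ℝ × ℝ} (hZ : Z ∈ rest X t) (hZu : Z ∉ u) :
    u ∈ us Z := by
  obtain ⟨m, m', hus, hm, hm', -, -, hcov⟩ := h.exists_two_lines ht hZ
  by_contra hn
  have : (nod (rest X t) u).card ≤ ({m, m'} : Finset (Set (ℝ × ℝ))).card := by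
    refine card_le_card_of_cover ?_ hu (fun hmem => hn ?_) (fun P hP => (mem_nod.mp hP).2)
      fun P hP => ?_
    · simp only [Finset.mem_insert, Finset.mem_singleton]
      rintro w (rfl | rfl) <;> assumption
    · simp only [Finset.mem_insert, Finset.mem_singleton] at hmem
      rw [hus]
      rcases hmem with rfl | rfl <;> simp
    · obtain ⟨hPY, hPu⟩ := mem_nod.mp hP
      rcases hcov P hPY (fun e => hZu (e ▸ hPu)) with h | h
      exacts [⟨m, by simp, h⟩, ⟨m', by simp, h⟩]
  have := Finset.card_le_two (a := m) (b := m')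
  omega

/-- Six points arranged as the vertices `V i` of a triangle together with one further point `M i`
on the side `m i` opposite to `V i`. -/
structure Six (Y : Finset (ℝ × ℝ)) (V M : Fin 3 → ℝ × ℝ) (m : Fin 3 → Set (ℝ × ℝ)) : Prop where
  mem : ∀ P, P ∈ Y ↔ (∃ i, P = V i) ∨ ∃ i, P = M i
  line : ∀ i, IsLn (m i)
  mV : ∀ i j, V j ∈ m i ↔ j ≠ i
  mM : ∀ i j, M j ∈ m i ↔ j = i

lemma Six.of_card {Y : Finset (ℝ × ℝ)} (hY : Y.card = 6) {V M : Fin 3 → ℝ × ℝ}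
    {m : Fin 3 → Set (ℝ × ℝ)} (hV : ∀ i, V i ∈ Y) (hM : ∀ i, M i ∈ Y) (line : ∀ i, IsLn (m i))
    (mV : ∀ i j, V j ∈ m i ↔ j ≠ i) (mM : ∀ i j, M j ∈ m i ↔ j = i) : Six Y V M m := by
  have hVi : Function.Injective V := fun i j hij => by
    by_contra hne
    exact (mV i i).mp (hij ▸ (mV i j).mpr (Ne.symm hne)) rfl
  have hMi : Function.Injective M := fun i j hij => ((mM i j).mp (hij ▸ (mM i i).mpr rfl)).symm
  have hVM : ∀ i j, V i ≠ M j := fun i j hij => by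
    obtain ⟨k, hk, hk'⟩ : ∃ k : Fin 3, k ≠ i ∧ k ≠ j :=
      (by decide : ∀ i j : Fin 3, ∃ k, k ≠ i ∧ k ≠ j) i j
    exact hk' ((mM k j).mp (hij ▸ (mV k i).mpr hk.symm)).symm
  have hinj : Function.Injective (Sum.elim V M) := hVi.sumElim hMi hVM
  have hsub : Finset.univ.image (Sum.elim V M) ⊆ Y := fun P hP => by
    obtain ⟨i, -, rfl⟩ := Finset.mem_image.mp hP
    cases i
    exacts [hV _, hM _]
  have hE := Finset.eq_of_subset_of_card_le hsub (by
    rw [hY, Finset.card_image_of_injective _ hinj]; simp)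
  refine ⟨fun P => ?_, line, mV, mM⟩
  simp [← hE, eq_comm]

lemma Six.of_points {Y : Finset (ℝ × ℝ)} (hY : Y.card = 6) {v₀ v₁ v₂ m₀ m₁ m₂ : ℝ × ℝ}
    {l₀ l₁ l₂ : Set (ℝ × ℝ)} (hv₀ : v₀ ∈ Y) (hv₁ : v₁ ∈ Y) (hv₂ : v₂ ∈ Y) (hm₀ : m₀ ∈ Y)
    (hm₁ : m₁ ∈ Y) (hm₂ : m₂ ∈ Y) (hl₀ : IsLn l₀) (hl₁ : IsLn l₁) (hl₂ : IsLn l₂)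
    (a₀₀ : v₀ ∉ l₀) (a₀₁ : v₁ ∈ l₀) (a₀₂ : v₂ ∈ l₀) (a₁₀ : v₀ ∈ l₁) (a₁₁ : v₁ ∉ l₁) (a₁₂ : v₂ ∈ l₁)
    (a₂₀ : v₀ ∈ l₂) (a₂₁ : v₁ ∈ l₂) (a₂₂ : v₂ ∉ l₂) (b₀₀ : m₀ ∈ l₀) (b₀₁ : m₁ ∉ l₀) (b₀₂ : m₂ ∉ l₀)
    (b₁₀ : m₀ ∉ l₁) (b₁₁ : m₁ ∈ l₁) (b₁₂ : m₂ ∉ l₁) (b₂₀ : m₀ ∉ l₂) (b₂₁ : m₁ ∉ l₂)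
    (b₂₂ : m₂ ∈ l₂) : Six Y ![v₀, v₁, v₂] ![m₀, m₁, m₂] ![l₀, l₁, l₂] := by
  refine Six.of_card hY ?_ ?_ ?_ ?_ ?_ <;> simp [Fin.forall_fin_succ, *]

lemma Config.exists_three_line (h : Config X us) (ht : IsT X t) {Q : ℝ × ℝ} (hQ : Q ∈ rest X t) :
    ∃ w, IsLn w ∧ Q ∉ w ∧ (nod (rest X t) w).card = 3 := by
  obtain ⟨m, m', -, hm, hm', hQm, hQm', hcov⟩ := h.exists_two_lines ht hQ
  have h1 : ((rest X t).erase Q).card ≤ (nod (rest X t) m ∪ nod (rest X t) m').card :=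
    Finset.card_le_card fun P hP => by
      obtain ⟨hPQ, hP⟩ := Finset.mem_erase.mp hP
      simp only [Finset.mem_union, mem_nod]
      have := hcov P hP hPQ
      tauto
  have h2 := Finset.card_union_le (nod (rest X t) m) (nod (rest X t) m')
  rw [Finset.card_erase_of_mem hQ, h.card_rest ht] at h1
  have h3 := h.card_nod_rest_le ht hm
  have h4 := h.card_nod_rest_le ht hm'
  by_cases h5 : (nod (rest X t) m).card = 3
  · exact ⟨m, hm, hQm, h5⟩
  · exact ⟨m', hm', hQm', by omega⟩

lemma exists_third {S : Finset (ℝ × ℝ)} (hS : S.card = 3) {P Q : ℝ × ℝ} (hP : P ∈ S) (hQ : Q ∈ S)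
    (hPQ : P ≠ Q) : ∃ R, R ≠ P ∧ R ≠ Q ∧ ∀ T, T ∈ S ↔ T = P ∨ T = Q ∨ T = R := by
  obtain ⟨R, hR⟩ := Finset.card_eq_one.mp (show ((S.erase P).erase Q).card = 1 by
    rw [Finset.card_erase_of_mem (Finset.mem_erase.mpr ⟨hPQ.symm, hQ⟩), Finset.card_erase_of_mem hP,
      hS])
  have hR' : R ∈ (S.erase P).erase Q := hR ▸ Finset.mem_singleton_self R
  simp only [Finset.mem_erase] at hR'
  refine ⟨R, hR'.2.1, hR'.1, fun T => ⟨fun hT => ?_, ?_⟩⟩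
  · by_contra! hn
    have : T ∈ (S.erase P).erase Q := by simp only [Finset.mem_erase]; tauto
    rw [hR, Finset.mem_singleton] at this
    exact hn.2.2 this
  · rintro (rfl | rfl | rfl)
    exacts [hP, hQ, hR'.2.2]

lemma Config.exists_six (h : Config X us) (ht : IsT X t) : ∃ V M m, Six (rest X t) V M m := by
  have h6 := h.card_rest ht
  obtain ⟨Z, hZ⟩ := Finset.card_pos.mp (show 0 < (rest X t).card by omega)
  obtain ⟨m, hm, -, m3⟩ := h.exists_three_line ht hZ
  have key : ∀ Q ∈ nod (rest X t) m, ∃ w, IsLn w ∧ Q ∉ w ∧ (nod (rest X t) w).card = 3 ∧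
      ∃ P ∈ nod (rest X t) m, P ∈ w := fun Q hQ => by
    obtain ⟨w, hw, hQw, w3⟩ := h.exists_three_line ht (mem_nod.mp hQ).1
    refine ⟨w, hw, hQw, w3, ?_⟩
    by_contra! hn
    have hsub : nod (rest X t) w ⊆ off (rest X t) m := fun P hP =>
      mem_off.mpr ⟨(mem_nod.mp hP).1, fun hPm =>
        hn P (mem_nod.mpr ⟨(mem_nod.mp hP).1, hPm⟩) (mem_nod.mp hP).2⟩
    have hc := card_nod_add_card_off (rest X t) m
    have he := Finset.eq_of_subset_of_card_le hsub (by omega)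
    refine h.not_two_lines ht hm hw fun P hP => ?_
    by_cases hPm : P ∈ m
    · exact .inl hPm
    · exact .inr (mem_nod.mp (he ▸ mem_off.mpr ⟨hP, hPm⟩ : P ∈ nod (rest X t) w)).2
  obtain ⟨Q, hQ⟩ := Finset.card_pos.mp (show 0 < (nod (rest X t) m).card by omega)
  obtain ⟨w, hw, hQw, w3, P, hPm, hPw⟩ := key Q hQ
  obtain ⟨w', hw', hPw', w3', P', hPm', hPw''⟩ := key P hPm
  obtain ⟨hPY, hPm⟩ := mem_nod.mp hPm
  obtain ⟨hPY', hPm'⟩ := mem_nod.mp hPm'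
  obtain ⟨hQY, hQm⟩ := mem_nod.mp hQ
  have hmw : m ≠ w := fun e => hQw (e ▸ hQm)
  have hmw' : m ≠ w' := fun e => hPw' (e ▸ hPm)
  have hww' : w ≠ w' := fun e => hPw' (e ▸ hPw)
  have hPP : P ≠ P' := fun e => hPw' (e ▸ hPw'')
  have uniq : ∀ {u v : Set (ℝ × ℝ)}, IsLn u → IsLn v → u ≠ v → ∀ {A B}, A ∈ u → A ∈ v → B ∈ u →
      B ∈ v → A = B := fun hu hv huv A B h1 h2 h3 h4 => by
    by_contra hAB
    exact huv (hu.eq_of_mem hv hAB h1 h3 h2 h4)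
  obtain ⟨S, hSY, hSw, hSw'⟩ : ∃ S ∈ rest X t, S ∈ w ∧ S ∈ w' := by
    by_contra! hn
    have hsub : (nod (rest X t) w).erase P ∪ (nod (rest X t) w').erase P' ⊆ off (rest X t) m := by
      intro R hR
      simp only [Finset.mem_union, Finset.mem_erase, mem_nod] at hR
      rw [mem_off]
      rcases hR with ⟨h1, h2, h3⟩ | ⟨h1, h2, h3⟩
      · exact ⟨h2, fun h4 => h1 (uniq hw hm hmw.symm h3 h4 hPw hPm)⟩
      · exact ⟨h2, fun h4 => h1 (uniq hw' hm hmw'.symm h3 h4 hPw'' hPm')⟩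
    have h1 := Finset.card_le_card hsub
    rw [Finset.card_union_of_disjoint (Finset.disjoint_left.mpr fun R h1 h2 => by
        simp only [Finset.mem_erase, mem_nod] at h1 h2
        exact hn R h1.2.1 h1.2.2 h2.2.2),
      Finset.card_erase_of_mem (mem_nod.mpr ⟨hPY, hPw⟩),
      Finset.card_erase_of_mem (mem_nod.mpr ⟨hPY', hPw''⟩), w3, w3'] at h1
    have := card_nod_add_card_off (rest X t) m
    omega
  have hSm : S ∉ m := fun hn =>
    hPP ((uniq hm hw hmw hPm hPw hn hSw).trans (uniq hm hw' hmw' hn hSw' hPm' hPw''))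
  have hPS : P ≠ S := fun e => hSm (e ▸ hPm)
  have hPS' : P' ≠ S := fun e => hSm (e ▸ hPm')
  have hP'w : P' ∉ w := fun hn => hPP (uniq hm hw hmw hPm hPw hPm' hn)
  obtain ⟨M₁, a1, a2, hM1⟩ := exists_third m3 (mem_nod.mpr ⟨hPY, hPm⟩) (mem_nod.mpr ⟨hPY', hPm'⟩) hPP
  obtain ⟨M₂, b1, b2, hM2⟩ := exists_third w3 (mem_nod.mpr ⟨hPY, hPw⟩) (mem_nod.mpr ⟨hSY, hSw⟩) hPS
  obtain ⟨M₃, c1, c2, hM3⟩ := exists_third w3' (mem_nod.mpr ⟨hPY', hPw''⟩)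
    (mem_nod.mpr ⟨hSY, hSw'⟩) hPS'
  obtain ⟨m1Y, m1m⟩ := mem_nod.mp ((hM1 M₁).mpr (by simp))
  obtain ⟨m2Y, m2m⟩ := mem_nod.mp ((hM2 M₂).mpr (by simp))
  obtain ⟨m3Y, m3m⟩ := mem_nod.mp ((hM3 M₃).mpr (by simp))
  have d1 : M₁ ∉ w := fun hn => a1 (uniq hm hw hmw m1m hn hPm hPw)
  have d2 : M₁ ∉ w' := fun hn => a2 (uniq hm hw' hmw' m1m hn hPm' hPw'')
  have d3 : M₂ ∉ m := fun hn => b1 (uniq hm hw hmw hn m2m hPm hPw)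
  have d4 : M₂ ∉ w' := fun hn => b2 (uniq hw hw' hww' m2m hn hSw hSw')
  have d5 : M₃ ∉ m := fun hn => c1 (uniq hm hw' hmw' hn m3m hPm' hPw'')
  have d6 : M₃ ∉ w := fun hn => c2 (uniq hw hw' hww' hn m3m hSw hSw')
  exact ⟨_, _, _, Six.of_points h6 hSY hPY' hPY m1Y m2Y m3Y hm hw hw' hSm hPm' hPm hSw hP'w hPw
    hSw' hPw'' hPw' m1m d3 d5 d1 m2m d6 d2 d4 m3m⟩

end Triples

section Unique
open scoped Classical

variable {X : Finset (ℝ × ℝ)} {us : ℝ × ℝ → Finset (Set (ℝ × ℝ))} {t t' : Finset (Set (ℝ × ℝ))}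
  {Y : Finset (ℝ × ℝ)} {V M : Fin 3 → ℝ × ℝ} {m : Fin 3 → Set (ℝ × ℝ)}

lemma Six.V_mem (s : Six Y V M m) (i : Fin 3) : V i ∈ Y := (s.mem _).mpr (.inl ⟨i, rfl⟩)

lemma Six.M_mem (s : Six Y V M m) (i : Fin 3) : M i ∈ Y := (s.mem _).mpr (.inr ⟨i, rfl⟩)

lemma Six.V_injective (s : Six Y V M m) : Function.Injective V := fun i j hij => by
  by_contra hne
  exact (s.mV i i).mp (hij ▸ (s.mV i j).mpr (Ne.symm hne)) rfl

lemma Six.M_injective (s : Six Y V M m) : Function.Injective M := fun i j hij =>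
  ((s.mM i j).mp (hij ▸ (s.mM i i).mpr rfl)).symm

lemma Six.V_ne_M (s : Six Y V M m) (i j : Fin 3) : V i ≠ M j := fun hij => by
  obtain ⟨k, hk, hk'⟩ := (by decide : ∀ i j : Fin 3, ∃ k, k ≠ i ∧ k ≠ j) i j
  exact hk' ((s.mM k j).mp (hij ▸ (s.mV k i).mpr hk.symm)).symm

lemma Six.three_le (s : Six Y V M m) (i : Fin 3) : 3 ≤ (nod Y (m i)).card := by
  obtain ⟨h1, h2, h3⟩ := (by decide : ∀ i : Fin 3, i + 1 ≠ i ∧ i + 2 ≠ i ∧ i + 1 ≠ i + 2) i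
  have hc : ({V (i + 1), V (i + 2), M i} : Finset (ℝ × ℝ)).card = 3 :=
    Finset.card_eq_three.mpr ⟨_, _, _, s.V_injective.ne h3, s.V_ne_M _ _, s.V_ne_M _ _, rfl⟩
  rw [← hc]
  refine Finset.card_le_card fun P hP => ?_
  simp only [Finset.mem_insert, Finset.mem_singleton] at hP
  rcases hP with rfl | rfl | rfl
  · exact mem_nod.mpr ⟨s.V_mem _, (s.mV _ _).mpr h1⟩
  · exact mem_nod.mpr ⟨s.V_mem _, (s.mV _ _).mpr h2⟩
  · exact mem_nod.mpr ⟨s.M_mem _, (s.mM _ _).mpr rfl⟩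

lemma Six.classify (s : Six Y V M m) {u : Set (ℝ × ℝ)} (hu : IsLn u)
    (h2 : 2 ≤ (nod Y u).card) :
    (∃ i, u = m i) ∨ (∃ i, V i ∈ u ∧ M i ∈ u) ∨ ∃ i, u = join (M (i + 1)) (M (i + 2)) := by
  obtain ⟨P, hP, Q, hQ, hPQ⟩ := Finset.one_lt_card.mp h2
  obtain ⟨hPY, hPu⟩ := mem_nod.mp hP
  obtain ⟨hQY, hQu⟩ := mem_nod.mp hQ
  rcases (s.mem P).mp hPY with ⟨i, rfl⟩ | ⟨i, rfl⟩ <;> rcases (s.mem Q).mp hQY with ⟨j, rfl⟩ | ⟨j, rfl⟩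
  · obtain ⟨k, hk, hk'⟩ := (by decide : ∀ i j : Fin 3, ∃ k, i ≠ k ∧ j ≠ k) i j
    exact .inl ⟨k, hu.eq_of_mem (s.line k) hPQ hPu hQu ((s.mV _ _).mpr hk) ((s.mV _ _).mpr hk')⟩
  · by_cases hij : i = j
    · exact .inr (.inl ⟨i, hPu, hij ▸ hQu⟩)
    · exact .inl ⟨j, hu.eq_of_mem (s.line j) hPQ hPu hQu ((s.mV _ _).mpr hij) ((s.mM _ _).mpr rfl)⟩
  · by_cases hij : j = i
    · exact .inr (.inl ⟨j, hQu, hij ▸ hPu⟩)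
    · exact .inl ⟨i, hu.eq_of_mem (s.line i) hPQ hPu hQu ((s.mM _ _).mpr rfl) ((s.mV _ _).mpr hij)⟩
  · have hij : i ≠ j := fun e => hPQ (e ▸ rfl)
    obtain ⟨k, ⟨rfl, rfl⟩ | ⟨rfl, rfl⟩⟩ := (by decide : ∀ i j : Fin 3, i ≠ j →
      ∃ k, (i = k + 1 ∧ j = k + 2) ∨ (j = k + 1 ∧ i = k + 2)) i j hij
    · exact .inr (.inr ⟨k, hu.eq_join hPQ hPu hQu⟩)
    · exact .inr (.inr ⟨k, hu.eq_join hPQ.symm hQu hPu⟩)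

lemma Six.join_mem_us (h : Config X us) (ht : IsT X t) (s : Six (rest X t) V M m) (i : Fin 3) :
    join (M (i + 1)) (M (i + 2)) ∈ us (V i) := by
  obtain ⟨h1, h2, h3⟩ := (by decide : ∀ i : Fin 3, i + 1 ≠ i ∧ i + 2 ≠ i ∧ i + 1 ≠ i + 2) i
  have hm := h.mem_us_of_three ht (s.line i) (s.three_le i) (s.V_mem i) fun hn =>
    (s.mV i i).mp hn rfl
  obtain ⟨u, v, hus, hu, hv, -, -, hcov⟩ := h.exists_two_lines ht (s.V_mem i)
  have hmt : m i ∉ t := fun hn => (mem_rest.mp (s.M_mem i)).2 _ hn ((s.mM i i).mpr rfl)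
  have c1 := hcov _ (s.M_mem (i + 1)) (s.V_ne_M _ _).symm
  have c2 := hcov _ (s.M_mem (i + 2)) (s.V_ne_M _ _).symm
  have n1 : M (i + 1) ∉ m i := fun hn => h1 ((s.mM _ _).mp hn)
  have n2 : M (i + 2) ∉ m i := fun hn => h2 ((s.mM _ _).mp hn)
  have hne := s.M_injective.ne h3
  rw [hus]
  simp only [hus, Finset.mem_insert, hmt, or_false] at hm
  rcases hm with rfl | rfl
  · rw [← hv.eq_join hne (c1.resolve_left n1) (c2.resolve_left n2)]; simp
  · rw [← hu.eq_join hne (c1.resolve_right n1) (c2.resolve_right n2)]; simp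

lemma Config.three_le_users (h : Config X us) (ht : IsT X t) {u : Set (ℝ × ℝ)} (hu : IsLn u)
    (h3 : 3 ≤ (nod (rest X t) u).card) : 3 ≤ (usr X us u ∩ rest X t).card := by
  have h1 := card_nod_add_card_off (rest X t) u
  rw [h.card_rest ht] at h1
  have h2 := h.card_nod_rest_le ht hu
  refine le_trans (by omega) (Finset.card_le_card (s := off (rest X t) u) fun P hP => ?_)
  obtain ⟨hP, hPu⟩ := mem_off.mp hP
  exact Finset.mem_inter.mpr ⟨mem_usr.mpr ⟨rest_subset hP, h.mem_us_of_three ht hu h3 hP hPu⟩, hP⟩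

lemma card_nod_rest_add (t : Finset (Set (ℝ × ℝ))) (u : Set (ℝ × ℝ)) :
    (nod (rest X t) u).card + (nod (X \ rest X t) u).card = (nod X u).card := by
  rw [← Finset.card_union_of_disjoint]
  · congr 1; ext P; simp only [Finset.mem_union, mem_nod, Finset.mem_sdiff]
    have := @rest_subset X t P; tauto
  · exact Finset.disjoint_left.mpr fun P h1 h2 =>
      (Finset.mem_sdiff.mp (mem_nod.mp h2).1).2 (mem_nod.mp h1).1

lemma Config.notMem_of_isT (h : Config X us) (ht : IsT X t) (ht' : IsT X t') (hne : t' ≠ t) :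
    ∀ u ∈ t', u ∉ t := by
  intro u hu hut
  have hY : rest X t' = rest X t := by rw [← h.usr_eq_rest ht hut, ← h.usr_eq_rest ht' hu]
  refine hne (Finset.eq_of_subset_of_card_le (fun v hv => ?_) (by rw [ht.card, ht'.card]))
  by_contra hvt
  have h1 := ht.card_nod_sdiff_le (ht'.line v hv) hvt
  have h2 := card_nod_rest_add (X := X) t v
  have h3 : (nod (rest X t) v).card = 0 := by
    rw [Finset.card_eq_zero, Finset.eq_empty_iff_forall_notMem]
    intro P hP
    rw [← hY] at hP
    exact (mem_rest.mp (mem_nod.mp hP).1).2 v hv (mem_nod.mp hP).2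
  have := ht'.five v hv
  omega

lemma Config.two_of_isT (h : Config X us) (ht : IsT X t) (ht' : IsT X t') (hne : t' ≠ t) :
    (∀ u ∈ t', (nod (rest X t) u).card = 2) ∧ ∀ P ∈ rest X t, P ∉ rest X t' := by
  have h2 : ∀ u ∈ t', 2 ≤ (nod (rest X t) u).card := fun u hu => by
    have := ht.card_nod_sdiff_le (ht'.line u hu) (h.notMem_of_isT ht ht' hne u hu)
    have := card_nod_rest_add (X := X) t u
    have := ht'.five u hu
    omega
  have hsub : t'.biUnion (nod (rest X t)) ⊆ rest X t :=
    Finset.biUnion_subset.mpr fun u _ => nod_subset _ u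
  have hsum : (t'.biUnion (nod (rest X t))).card = ∑ u ∈ t', (nod (rest X t) u).card := by
    rw [Finset.card_biUnion]
    intro u hu v hv huv
    exact Finset.disjoint_left.mpr fun P hP hP' =>
      ht'.disj u hu v hv huv P (rest_subset (mem_nod.mp hP).1) (mem_nod.mp hP).2 (mem_nod.mp hP').2
  have hle := Finset.card_le_card hsub
  rw [hsum, h.card_rest ht] at hle
  have h6 : ∑ u ∈ t', 2 = 6 := by simp [ht'.card]
  have heq := (Finset.sum_eq_sum_iff_of_le h2).mp
    (le_antisymm (Finset.sum_le_sum h2) (by rw [h6]; exact hle))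
  refine ⟨fun u hu => (heq u hu).symm, fun P hP hP' => ?_⟩
  have hE := Finset.eq_of_subset_of_card_le hsub (by
    rw [hsum, h.card_rest ht, ← Finset.sum_congr rfl heq, h6])
  rw [← hE, Finset.mem_biUnion] at hP
  obtain ⟨u, hu, hPu⟩ := hP
  exact (mem_rest.mp hP').2 u hu (mem_nod.mp hPu).2

lemma Config.diag_of_isT (h : Config X us) (ht : IsT X t) (ht' : IsT X t') (hne : t' ≠ t)
    (s : Six (rest X t) V M m) {u : Set (ℝ × ℝ)} (hu : u ∈ t') : ∃ i, V i ∈ u ∧ M i ∈ u := by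
  obtain ⟨h2, hd⟩ := h.two_of_isT ht ht' hne
  rcases s.classify (ht'.line u hu) (h2 u hu).ge with ⟨i, rfl⟩ | hd' | ⟨i, rfl⟩
  · have := s.three_le i
    have := h2 _ hu
    omega
  · exact hd'
  · refine absurd ?_ (hd _ (s.V_mem i))
    rw [← h.usr_eq_rest ht' hu]
    exact mem_usr.mpr ⟨rest_subset (s.V_mem i), s.join_mem_us h ht i⟩

lemma Config.mem_of_diag (h : Config X us) (ht : IsT X t) (ht' : IsT X t') (hne : t' ≠ t)
    (s : Six (rest X t) V M m) {v : Set (ℝ × ℝ)} (hv : IsLn v) {i : Fin 3} (hVi : V i ∈ v)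
    (hMi : M i ∈ v) : v ∈ t' := by
  obtain ⟨h2, hd⟩ := h.two_of_isT ht ht' hne
  obtain ⟨u, hu, hVu⟩ := exists_line_of_notMem_rest (rest_subset (s.V_mem i)) (hd _ (s.V_mem i))
  obtain ⟨j, hVj, hMj⟩ := h.diag_of_isT ht ht' hne s hu
  have hij : i = j := by
    by_contra hij
    have : ({V i, V j, M j} : Finset (ℝ × ℝ)).card ≤ (nod (rest X t) u).card :=
      Finset.card_le_card fun P hP => by
        simp only [Finset.mem_insert, Finset.mem_singleton] at hP
        rcases hP with rfl | rfl | rfl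
        exacts [mem_nod.mpr ⟨s.V_mem i, hVu⟩, mem_nod.mpr ⟨s.V_mem j, hVj⟩,
          mem_nod.mpr ⟨s.M_mem j, hMj⟩]
    rw [h2 u hu, Finset.card_eq_three.mpr
      ⟨_, _, _, s.V_injective.ne hij, s.V_ne_M i j, s.V_ne_M j j, rfl⟩] at this
    omega
  subst hij
  rw [hv.eq_of_mem (ht'.line u hu) (s.V_ne_M i i) hVi hMi hVj hMj]
  exact hu

lemma Config.eq_of_isT (h : Config X us) (ht : IsT X t) (ht' : IsT X t') (hne : t' ≠ t)
    {t'' : Finset (Set (ℝ × ℝ))} (ht'' : IsT X t'') : t'' = t ∨ t'' = t' := by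
  by_cases h0 : t'' = t
  · exact .inl h0
  obtain ⟨V, M, m, s⟩ := h.exists_six ht
  refine .inr (Finset.eq_of_subset_of_card_le (fun u hu => ?_) (by rw [ht'.card, ht''.card]))
  obtain ⟨i, h1, h2⟩ := h.diag_of_isT ht ht'' h0 s hu
  exact h.mem_of_diag ht ht' hne s (ht''.line u hu) h1 h2

lemma Config.classify_of_isT (h : Config X us) (ht : IsT X t) (ht' : IsT X t') (hne : t' ≠ t)
    (s : Six (rest X t) V M m) {v : Set (ℝ × ℝ)} (hv : IsLn v) (hvt : v ∉ t')
    (h2 : 2 ≤ (nod (rest X t) v).card) : 1 ≤ (usr X us v ∩ rest X t).card ∧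
      ((nod (rest X t) v).card = 2 → ∃ i, v = join (M (i + 1)) (M (i + 2))) := by
  rcases s.classify hv h2 with ⟨i, rfl⟩ | ⟨i, h1, h2⟩ | ⟨i, rfl⟩
  · have := s.three_le i
    have := h.three_le_users ht hv this
    exact ⟨by omega, by omega⟩
  · exact absurd (h.mem_of_diag ht ht' hne s hv h1 h2) hvt
  · exact ⟨Finset.card_pos.mpr ⟨V i, Finset.mem_inter.mpr
      ⟨mem_usr.mpr ⟨rest_subset (s.V_mem i), s.join_mem_us h ht i⟩, s.V_mem i⟩⟩, fun _ => ⟨i, rfl⟩⟩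

lemma card_sdiff_sdiff {S A B : Finset (ℝ × ℝ)} (hAB : Disjoint A B) (hA : A ⊆ S) (hB : B ⊆ S) :
    ((S \ A) \ B).card + A.card + B.card = S.card := by
  have h1 := Finset.card_sdiff_add_card_eq_card hA
  have h2 := Finset.card_sdiff_add_card_eq_card (s := B) (t := S \ A) fun P hP =>
    Finset.mem_sdiff.mpr ⟨hB hP, fun h => Finset.disjoint_left.mp hAB h hP⟩
  omega

lemma Config.isT_unique (h : Config X us) (ht : IsT X t) (ht' : IsT X t') : t' = t := by
  by_contra hne
  have hne' : t ≠ t' := Ne.symm hne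
  obtain ⟨V, M, m, s⟩ := h.exists_six ht
  obtain ⟨V', M', m', s'⟩ := h.exists_six ht'
  obtain ⟨-, hd⟩ := h.two_of_isT ht ht' hne
  have hdis : Disjoint (rest X t) (rest X t') := Finset.disjoint_left.mpr hd
  set G := (X \ rest X t) \ rest X t' with hG
  have hGc : G.card = 9 := by
    have e : G.card + (rest X t).card + (rest X t').card = X.card :=
      card_sdiff_sdiff hdis rest_subset rest_subset
    have := h.card_rest ht
    have := h.card_rest ht'
    have := h.card
    omega
  have mG : ∀ D, D ∈ G ↔ D ∈ X ∧ D ∉ rest X t ∧ D ∉ rest X t' := fun D => by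
    simp only [hG, Finset.mem_sdiff]; tauto
  have claim : ∀ v, IsLn v → v ∉ t → v ∉ t' → 2 ≤ (nod (rest X t') v).card →
      ∀ D ∈ G, v ∈ us D → (nod (rest X t') v).card = 2 ∧ (usr X us v ∩ G).card ≤ 2 := by
    intro v hv hvt hvt' hw D hD hDv
    obtain ⟨hDX, hDY, hDY'⟩ := (mG D).mp hD
    have k5 := h.le5 v hv
    have a1 := card_nod_rest_add (X := X) t v
    have a2 := card_nod_rest_add (X := X) t' v
    have a3 := ht.card_nod_sdiff_le hv hvt
    have a4 := ht'.card_nod_sdiff_le hv hvt'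
    have z3 := h.card_nod_rest_le ht hv
    have w3 := h.card_nod_rest_le ht' hv
    have a5 : (nod X v).card = (nod G v).card + (nod (rest X t) v).card +
        (nod (rest X t') v).card := by
      have : nod G v = (nod X v \ nod (rest X t) v) \ nod (rest X t') v := by
        ext P; simp only [mem_nod, mG, Finset.mem_sdiff]; tauto
      rw [this, card_sdiff_sdiff _ (nod_mono rest_subset _) (nod_mono rest_subset _)]
      exact hdis.mono (nod_subset _ _) (nod_subset _ _)
    have us3 : (usr X us v ∩ G).card + (usr X us v ∩ rest X t).card +
        (usr X us v ∩ rest X t').card = (usr X us v).card := by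
      have : usr X us v ∩ G =
          (usr X us v \ (usr X us v ∩ rest X t)) \ (usr X us v ∩ rest X t') := by
        ext P; simp only [Finset.mem_inter, mG, Finset.mem_sdiff, mem_usr]; tauto
      rw [this, card_sdiff_sdiff _ Finset.inter_subset_left Finset.inter_subset_left]
      exact hdis.mono Finset.inter_subset_right Finset.inter_subset_right
    have uG : 1 ≤ (usr X us v ∩ G).card :=
      Finset.card_pos.mpr ⟨D, Finset.mem_inter.mpr ⟨mem_usr.mpr ⟨hDX, hDv⟩, hD⟩⟩
    have uY' := (h.classify_of_isT ht' ht hne' s' hv hvt hw).1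
    have uY := fun hz => (h.classify_of_isT ht ht' hne s hv hvt' hz).1
    have u3 := h.three_le_users ht hv
    have u3' := h.three_le_users ht' hv
    have c5 : (nod X v).card = 5 → (usr X us v).card ≤ 4 := fun hk => by
      by_contra! hlt
      obtain ⟨t'', ht'', hvt''⟩ := h.exists_isT_of_five hv hk hlt
      rcases h.eq_of_isT ht ht' hne ht'' with rfl | rfl
      exacts [hvt hvt'', hvt' hvt'']
    have c4 := h.card_usr_le_of_four (u := v)
    have c3 : (nod X v).card ≤ 3 → (usr X us v).card ≤ 1 := fun hk => by
      by_contra! hlt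
      obtain ⟨E, hE, hED⟩ := Finset.exists_mem_ne hlt D
      obtain ⟨-, t'', ht'', hsub, -⟩ := h.two_users hk hED.symm (mem_usr.mpr ⟨hDX, hDv⟩) hE
      obtain ⟨l, hl⟩ := Finset.card_pos.mp (show 0 < t''.card by rw [ht''.card]; omega)
      have : D ∈ rest X t'' := h.usr_eq_rest ht'' hl ▸ mem_usr.mpr ⟨hDX, hsub hl⟩
      rcases h.eq_of_isT ht ht' hne ht'' with rfl | rfl
      exacts [hDY this, hDY' this]
    omega
  have hsub : G ⊆ (Finset.univ : Finset (Fin 3)).biUnion fun i =>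
      usr X us (join (M' (i + 1)) (M' (i + 2))) ∩ G := by
    intro D hD
    obtain ⟨hDX, hDY, hDY'⟩ := (mG D).mp hD
    obtain ⟨v, hv, hv2⟩ : ∃ v ∈ us D, 2 ≤ (nod (rest X t') v).card := by
      by_contra! hn
      have h1 : rest X t' ⊆ (us D).biUnion (nod (rest X t')) := fun P hP => by
        obtain ⟨v, hv, hPv⟩ := h.cover D hDX P (rest_subset hP) fun e => hDY' (e ▸ hP)
        exact Finset.mem_biUnion.mpr ⟨v, hv, mem_nod.mpr ⟨hP, hPv⟩⟩
      have h2 := Finset.card_le_card h1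
      have h3 := Finset.card_biUnion_le_card_mul (us D) (nod (rest X t')) 1 fun v hv => by
        have := hn v hv; omega
      rw [h.five D hDX] at h3
      rw [h.card_rest ht'] at h2
      omega
    have nt : ∀ {t}, IsT X t → D ∉ rest X t → v ∉ t := fun ht hDt hvt =>
      hDt (h.usr_eq_rest ht hvt ▸ mem_usr.mpr ⟨hDX, hv⟩)
    have hl := h.line D hDX v hv
    have hw := (claim v hl (nt ht hDY) (nt ht' hDY') hv2 D hD hv).1
    obtain ⟨i, rfl⟩ := (h.classify_of_isT ht' ht hne' s' hl (nt ht hDY) hv2).2 hw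
    exact Finset.mem_biUnion.mpr ⟨i, Finset.mem_univ _, Finset.mem_inter.mpr
      ⟨mem_usr.mpr ⟨hDX, hv⟩, hD⟩⟩
  have h1 := Finset.card_le_card hsub
  have h2 := Finset.card_biUnion_le_card_mul (Finset.univ : Finset (Fin 3))
    (fun i => usr X us (join (M' (i + 1)) (M' (i + 2))) ∩ G) 2 fun i _ => by
      by_contra! hlt
      obtain ⟨D, hD⟩ := Finset.card_pos.mp (Nat.zero_lt_of_lt hlt)
      obtain ⟨hDu, hDG⟩ := Finset.mem_inter.mp hD
      obtain ⟨hDX, hDv⟩ := mem_usr.mp hDu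
      obtain ⟨-, hDY, hDY'⟩ := (mG D).mp hDG
      have nt : ∀ {t}, IsT X t → D ∉ rest X t → join (M' (i + 1)) (M' (i + 2)) ∉ t :=
        fun ht hDt hvt => hDt (h.usr_eq_rest ht hvt ▸ hDu)
      have hne12 : M' (i + 1) ≠ M' (i + 2) :=
        s'.M_injective.ne ((by decide : ∀ i : Fin 3, i + 1 ≠ i + 2) i)
      have := (claim _ (h.line D hDX _ hDv) (nt ht hDY) (nt ht' hDY') (Finset.one_lt_card.mpr
        ⟨_, mem_nod.mpr ⟨s'.M_mem _, left_mem_join _ _⟩, _,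
          mem_nod.mpr ⟨s'.M_mem _, right_mem_join _ _⟩, hne12⟩) D hDG hDv).2
      omega
  simp only [Finset.card_univ, Fintype.card_fin] at h2
  omega

end Unique

section Ranks
open scoped Classical

variable {ι α : Type*} {L : Finset ι} {x y e : ι → α} {E : Finset α} {ρ σ : α → ℝ}

lemma exists_min_fiber {A : Finset α} (hA : A.Nonempty) (ρ : α → ℝ) :
    ∃ F ⊆ A, 1 ≤ F.card ∧ ∀ p ∈ F, ∀ q ∈ A, ρ p ≤ ρ q ∧ (ρ q ≤ ρ p → q ∈ F) := by
  obtain ⟨a, ha, hmin⟩ := A.exists_min_image ρ hA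
  refine ⟨A.filter fun q => ρ q ≤ ρ a, Finset.filter_subset _ _,
    Finset.card_pos.mpr ⟨a, Finset.mem_filter.mpr ⟨ha, le_rfl⟩⟩, fun p hp q hq => ?_⟩
  obtain ⟨hp, hpa⟩ := Finset.mem_filter.mp hp
  exact ⟨hpa.trans (hmin q hq), fun hqp => Finset.mem_filter.mpr ⟨hq, hqp.trans hpa⟩⟩

lemma exists_hook (hE : ∀ u ∈ L, e u ∈ E) (hE5 : E.card ≤ 5)
    (hxe : ∀ u ∈ L, ∀ w ∈ L, x u = x w → e u = e w → u = w)
    (hye : ∀ u ∈ L, ∀ w ∈ L, y u = y w → e u = e w → u = w)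
    (hrank : ∀ u ∈ L, ∀ w ∈ L, e u = e w → (ρ (x u) ≤ ρ (x w) ↔ σ (y u) ≤ σ (y w)))
    {A B : Finset α} (hA : A.Nonempty) (hB : B.Nonempty)
    (hρ : ∀ F ⊆ A, (∀ p ∈ F, ∀ q ∈ F, ρ p = ρ q) → F.card ≤ 2)
    (hσ : ∀ F ⊆ B, (∀ p ∈ F, ∀ q ∈ F, σ p = σ q) → F.card ≤ 2) :
    ∃ F ⊆ A, ∃ G ⊆ B, F.card = G.card ∧ 1 ≤ F.card ∧ F.card ≤ 2 ∧
      (L.filter fun u => x u ∈ A ∧ y u ∈ B).card ≤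
        (L.filter fun u => x u ∈ A \ F ∧ y u ∈ B \ G).card + 5 * F.card := by
  obtain ⟨F₀, hFA, hF1, hF⟩ := exists_min_fiber hA ρ
  obtain ⟨G₀, hGB, hG1, hG⟩ := exists_min_fiber hB σ
  have hF2 := hρ F₀ hFA fun p hp q hq =>
    le_antisymm (hF p hp q (hFA hq)).1 (hF q hq p (hFA hp)).1
  have hG2 := hσ G₀ hGB fun p hp q hq =>
    le_antisymm (hG p hp q (hGB hq)).1 (hG q hq p (hGB hp)).1
  obtain ⟨F, hFF, hFc⟩ := Finset.exists_subset_card_eq (min_le_left F₀.card G₀.card)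
  obtain ⟨G, hGG, hGc⟩ := Finset.exists_subset_card_eq (min_le_right F₀.card G₀.card)
  refine ⟨F, hFF.trans hFA, G, hGG.trans hGB, by omega, by omega, by omega, ?_⟩
  have hor : F = F₀ ∨ G = G₀ := by
    rcases le_total F₀.card G₀.card with hle | hle
    · exact .inl (Finset.eq_of_subset_of_card_le hFF (by omega))
    · exact .inr (Finset.eq_of_subset_of_card_le hGG (by omega))
  set H := L.filter fun u => (x u ∈ A ∧ y u ∈ B) ∧ (x u ∈ F ∨ y u ∈ G) with hH
  have hsplit : (L.filter fun u => x u ∈ A ∧ y u ∈ B) ⊆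
      (L.filter fun u => x u ∈ A \ F ∧ y u ∈ B \ G) ∪ H := by
    intro u hu
    simp only [hH, Finset.mem_union, Finset.mem_filter, Finset.mem_sdiff] at hu ⊢
    tauto
  have hHE : H.card ≤ F.card * E.card := by
    refine Finset.card_le_mul_card_image_of_maps_to (f := e)
      (fun u hu => hE u (Finset.mem_filter.mp hu).1) _ fun c _ => ?_
    have mem : ∀ u ∈ H.filter (e · = c), (u ∈ L ∧ (x u ∈ A ∧ y u ∈ B) ∧ (x u ∈ F ∨ y u ∈ G)) ∧
        e u = c := fun u hu => by simpa [hH] using hu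
    have key : (∀ u ∈ H.filter (e · = c), x u ∈ F) ∨ ∀ u ∈ H.filter (e · = c), y u ∈ G := by
      by_contra! hn
      obtain ⟨⟨u, hu, huF⟩, w, hw, hwG⟩ := hn
      obtain ⟨⟨huL, ⟨huA, huB⟩, hu'⟩, hue⟩ := mem u hu
      obtain ⟨⟨hwL, ⟨hwA, hwB⟩, hw'⟩, hwe⟩ := mem w hw
      have huG := hu'.resolve_left huF
      have hwF := hw'.resolve_right hwG
      have r1 := hrank w hwL u huL (hwe.trans hue.symm)
      have r2 := hrank u huL w hwL (hue.trans hwe.symm)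
      have f := hF _ (hFF hwF) _ huA
      have g := hG _ (hGG huG) _ hwB
      have f' := f.2 (r2.mpr g.1)
      have g' := g.2 (r1.mp f.1)
      rcases hor with rfl | rfl
      exacts [huF f', hwG g']
    rcases key with hk | hk
    · refine Finset.card_le_card_of_injOn x hk fun u hu w hw huw => ?_
      obtain ⟨⟨huL, -⟩, hue⟩ := mem u hu
      obtain ⟨⟨hwL, -⟩, hwe⟩ := mem w hw
      exact hxe u huL w hwL huw (hue.trans hwe.symm)
    · rw [show F.card = G.card by omega]
      refine Finset.card_le_card_of_injOn y hk fun u hu w hw huw => ?_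
      obtain ⟨⟨huL, -⟩, hue⟩ := mem u hu
      obtain ⟨⟨hwL, -⟩, hwe⟩ := mem w hw
      exact hye u huL w hwL huw (hue.trans hwe.symm)
  have h1 := Finset.card_le_card hsplit
  have h2 := Finset.card_union_le (L.filter fun u => x u ∈ A \ F ∧ y u ∈ B \ G) H
  have h3 : F.card * E.card ≤ F.card * 5 := Nat.mul_le_mul_left _ hE5
  omega

lemma card_le_of_ranks {A B : Finset α} (hA5 : A.card = 5) (hB5 : B.card = 5)
    (hA : ∀ u ∈ L, x u ∈ A) (hB : ∀ u ∈ L, y u ∈ B)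
    (hE : ∀ u ∈ L, e u ∈ E) (hE5 : E.card ≤ 5)
    (hxy : ∀ u ∈ L, ∀ w ∈ L, x u = x w → y u = y w → u = w)
    (hxe : ∀ u ∈ L, ∀ w ∈ L, x u = x w → e u = e w → u = w)
    (hye : ∀ u ∈ L, ∀ w ∈ L, y u = y w → e u = e w → u = w)
    (hrank : ∀ u ∈ L, ∀ w ∈ L, e u = e w → (ρ (x u) ≤ ρ (x w) ↔ σ (y u) ≤ σ (y w)))
    (hρ : ∀ F ⊆ A, (∀ p ∈ F, ∀ q ∈ F, ρ p = ρ q) → F.card ≤ 2)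
    (hσ : ∀ F ⊆ B, (∀ p ∈ F, ∀ q ∈ F, σ p = σ q) → F.card ≤ 2) : L.card ≤ 19 := by
  have hmul : ∀ A B : Finset α, (L.filter fun u => x u ∈ A ∧ y u ∈ B).card ≤ A.card * B.card := by
    intro A B
    rw [← Finset.card_product]
    refine Finset.card_le_card_of_injOn (fun u => (x u, y u)) (fun u hu => ?_)
      fun u hu w hw huw => ?_
    · exact Finset.mem_coe.mpr (Finset.mem_product.mpr (Finset.mem_filter.mp hu).2)
    · exact hxy u (Finset.mem_filter.mp hu).1 w (Finset.mem_filter.mp hw).1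
        (Prod.ext_iff.mp huw).1 (Prod.ext_iff.mp huw).2
  have h0 : (L.filter fun u => x u ∈ A ∧ y u ∈ B) = L :=
    Finset.filter_true_of_mem fun u hu => ⟨hA u hu, hB u hu⟩
  obtain ⟨F, hF, G, hG, hFG, hF1, hF2, hc⟩ := exists_hook hE hE5 hxe hye hrank
    (Finset.card_pos.mp (by omega)) (Finset.card_pos.mp (by omega)) hρ hσ
  rw [h0] at hc
  have cA := Finset.card_sdiff_add_card_eq_card hF
  have cB := Finset.card_sdiff_add_card_eq_card hG
  have hm := hmul (A \ F) (B \ G)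
  rcases (by omega : F.card = 2 ∨ F.card = 1) with hj | hj
  · rw [show (A \ F).card = 3 by omega, show (B \ G).card = 3 by omega] at hm
    omega
  obtain ⟨F', hF', G', hG', hFG', hF1', hF2', hc'⟩ := exists_hook hE hE5 hxe hye hrank
    (A := A \ F) (B := B \ G) (Finset.card_pos.mp (by omega)) (Finset.card_pos.mp (by omega))
    (fun K hK => hρ K (hK.trans Finset.sdiff_subset))
    (fun K hK => hσ K (hK.trans Finset.sdiff_subset))
  have cA' := Finset.card_sdiff_add_card_eq_card hF'
  have cB' := Finset.card_sdiff_add_card_eq_card hG'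
  have hm' := hmul ((A \ F) \ F') ((B \ G) \ G')
  rcases (by omega : F'.card = 2 ∨ F'.card = 1) with hj' | hj'
  · rw [show ((A \ F) \ F').card = 2 by omega, show ((B \ G) \ G').card = 2 by omega] at hm'
    omega
  · rw [show ((A \ F) \ F').card = 3 by omega, show ((B \ G) \ G').card = 3 by omega] at hm'
    omega

end Ranks

/-- The determinant of three affine functions. -/
def det3 (a b c : Fin 3 → ℝ) : ℝ :=
  a 0 * (b 1 * c 2 - b 2 * c 1) - a 1 * (b 0 * c 2 - b 2 * c 0) + a 2 * (b 0 * c 1 - b 1 * c 0)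

/-- The determinant of the homogeneous coordinates of three points. -/
def det3pt (P Q R : ℝ × ℝ) : ℝ :=
  P.1 * (Q.2 - R.2) - P.2 * (Q.1 - R.1) + (Q.1 * R.2 - Q.2 * R.1)

lemma IsLn.det3pt_eq_zero {u : Set (ℝ × ℝ)} (hu : IsLn u) {P Q R : ℝ × ℝ} (hP : P ∈ u) (hQ : Q ∈ u)
    (hR : R ∈ u) : det3pt P Q R = 0 := by
  obtain ⟨v, hv, rfl⟩ := hu
  simp only [aff, Set.mem_ofPred_eq] at hP hQ hR
  have h0 : v 0 * det3pt P Q R = 0 := by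
    simp only [det3pt]
    linear_combination (Q.2 - R.2) * hP + (R.2 - P.2) * hQ + (P.2 - Q.2) * hR
  have h1 : v 1 * det3pt P Q R = 0 := by
    simp only [det3pt]
    linear_combination (R.1 - Q.1) * hP + (P.1 - R.1) * hQ + (Q.1 - P.1) * hR
  rcases hv with hv | hv
  exacts [(mul_eq_zero.mp h0).resolve_left hv, (mul_eq_zero.mp h1).resolve_left hv]

lemma det3_mul_det3pt (a b c : Fin 3 → ℝ) (P Q R : ℝ × ℝ) :
    det3 a b c * det3pt P Q R = aff a P * (aff b Q * aff c R - aff b R * aff c Q) -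
      aff a Q * (aff b P * aff c R - aff b R * aff c P) +
      aff a R * (aff b P * aff c Q - aff b Q * aff c P) := by
  simp only [det3, det3pt, aff]; ring

lemma det3_swap (a b c : Fin 3 → ℝ) : det3 a b c = -det3 a c b := by simp only [det3]; ring

lemma det3_rotate (a b c : Fin 3 → ℝ) : det3 a b c = det3 b c a := by simp only [det3]; ring

lemma eq_of_ratio {a b c : Fin 3 → ℝ} (hd : det3 a b c ≠ 0) {P Q : ℝ × ℝ} (hP : aff a P = 0)
    (hQ : aff a Q = 0) (hcP : aff c P ≠ 0) (h : aff b P * aff c Q = aff b Q * aff c P) : P = Q := by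
  have h1 : ∀ z : ℝ, det3 a b c * z = 0 → z = 0 := fun z hz => (mul_eq_zero.mp hz).resolve_left hd
  have e3 : aff c Q - aff c P = 0 := h1 _ (by
    simp only [det3, aff] at *
    linear_combination (b 0 * c 1 - b 1 * c 0) * ((c 0 * Q.1 + c 1 * Q.2 + c 2) * hP -
      (c 0 * P.1 + c 1 * P.2 + c 2) * hQ) + (a 1 * c 0 - a 0 * c 1) * h)
  have e1 : aff c P * (P.1 - Q.1) = 0 := h1 _ (by
    have : aff c Q = aff c P := by linarith
    rw [this] at h
    simp only [det3, aff] at *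
    linear_combination (b 1 * c 2 - b 2 * c 1) * (c 0 * P.1 + c 1 * P.2 + c 2) * (hP - hQ) +
      (a 2 * c 1 - a 1 * c 2) * h + (a 1 * b 2 - a 2 * b 1) * (c 0 * P.1 + c 1 * P.2 + c 2) * (-this))
  have e2 : aff c P * (P.2 - Q.2) = 0 := h1 _ (by
    have : aff c Q = aff c P := by linarith
    rw [this] at h
    simp only [det3, aff] at *
    linear_combination (b 2 * c 0 - b 0 * c 2) * (c 0 * P.1 + c 1 * P.2 + c 2) * (hP - hQ) +
      (a 0 * c 2 - a 2 * c 0) * h + (a 2 * b 0 - a 0 * b 2) * (c 0 * P.1 + c 1 * P.2 + c 2) * (-this))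
  exact Prod.ext (by linarith [(mul_eq_zero.mp e1).resolve_left hcP])
    (by linarith [(mul_eq_zero.mp e2).resolve_left hcP])

section ThreeLines
open scoped Classical

lemma card_le_two_of_abs {A F : Finset (ℝ × ℝ)} {q : ℝ × ℝ → ℝ}
    (hq : ∀ P ∈ A, ∀ Q ∈ A, q P = q Q → P = Q) (hF : F ⊆ A)
    (h : ∀ P ∈ F, ∀ Q ∈ F, |q P| = |q Q|) : F.card ≤ 2 := by
  by_contra! h2
  obtain ⟨P, Q, R, hP, hQ, hR, hPQ, hPR, hQR⟩ := Finset.two_lt_card_iff.mp h2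
  have n1 := mt (hq P (hF hP) Q (hF hQ)) hPQ
  have n2 := mt (hq P (hF hP) R (hF hR)) hPR
  have n3 := mt (hq Q (hF hQ) R (hF hR)) hQR
  have e1 := (abs_eq_abs.mp (h P hP Q hQ)).resolve_left n1
  have e2 := (abs_eq_abs.mp (h P hP R hR)).resolve_left n2
  exact n3 (by linarith)

lemma card_le_two_of_inj {A F : Finset (ℝ × ℝ)} {q : ℝ × ℝ → ℝ}
    (hq : ∀ P ∈ A, ∀ Q ∈ A, q P = q Q → P = Q) (hF : F ⊆ A)
    (h : ∀ P ∈ F, ∀ Q ∈ F, q P = q Q) : F.card ≤ 2 :=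
  card_le_two_of_abs hq hF fun P hP Q hQ => by rw [h P hP Q hQ]

lemma card_trisecants_le {l₁ l₂ l₃ : Set (ℝ × ℝ)} (h₁ : IsLn l₁) (h₂ : IsLn l₂) (h₃ : IsLn l₃)
    {S₁ S₂ S₃ : Finset (ℝ × ℝ)} (c₁ : S₁.card = 5) (c₂ : S₂.card = 5) (c₃ : S₃.card = 5)
    (hS₁ : ∀ P ∈ S₁, P ∈ l₁ ∧ P ∉ l₂ ∧ P ∉ l₃) (hS₂ : ∀ P ∈ S₂, P ∉ l₁ ∧ P ∈ l₂ ∧ P ∉ l₃)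
    (hS₃ : ∀ P ∈ S₃, P ∉ l₁ ∧ P ∉ l₂ ∧ P ∈ l₃) {L : Finset (Set (ℝ × ℝ))}
    (hL : ∀ u ∈ L, IsLn u ∧ (∃ P ∈ S₁, P ∈ u) ∧ (∃ P ∈ S₂, P ∈ u) ∧ ∃ P ∈ S₃, P ∈ u) :
    L.card ≤ 19 := by
  choose! hln hx hy he using hL
  choose! x hxS hxu using hx
  choose! y hyS hyu using hy
  choose! e heS heu using he
  obtain ⟨a, ha, rfl⟩ := h₁
  obtain ⟨b, hb, rfl⟩ := h₂
  obtain ⟨c, hc, rfl⟩ := h₃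
  simp only [Set.mem_ofPred_eq] at hS₁ hS₂ hS₃
  have hxy : ∀ u ∈ L, x u ≠ y u := fun u hu h =>
    (hS₁ _ (hxS u hu)).2.1 (h ▸ (hS₂ _ (hyS u hu)).2.1)
  have hxe : ∀ u ∈ L, x u ≠ e u := fun u hu h =>
    (hS₁ _ (hxS u hu)).2.2 (h ▸ (hS₃ _ (heS u hu)).2.2)
  have hye : ∀ u ∈ L, y u ≠ e u := fun u hu h =>
    (hS₂ _ (hyS u hu)).2.2 (h ▸ (hS₃ _ (heS u hu)).2.2)
  have hcol : ∀ u ∈ L, det3pt (x u) (y u) (e u) = 0 := fun u hu =>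
    (hln u hu).det3pt_eq_zero (hxu u hu) (hyu u hu) (heu u hu)
  have main : ∀ ρ σ : ℝ × ℝ → ℝ,
      (∀ u ∈ L, ∀ w ∈ L, e u = e w → (ρ (x u) ≤ ρ (x w) ↔ σ (y u) ≤ σ (y w))) →
      (∀ F ⊆ S₁, (∀ p ∈ F, ∀ q ∈ F, ρ p = ρ q) → F.card ≤ 2) →
      (∀ F ⊆ S₂, (∀ p ∈ F, ∀ q ∈ F, σ p = σ q) → F.card ≤ 2) → L.card ≤ 19 :=
    fun ρ σ h1 h2 h3 => card_le_of_ranks c₁ c₂ hxS hyS heS c₃.le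
      (fun u hu w hw h h' => (hln u hu).eq_of_mem (hln w hw) (hxy u hu) (hxu u hu) (hyu u hu)
        (h ▸ hxu w hw) (h' ▸ hyu w hw))
      (fun u hu w hw h h' => (hln u hu).eq_of_mem (hln w hw) (hxe u hu) (hxu u hu) (heu u hu)
        (h ▸ hxu w hw) (h' ▸ heu w hw))
      (fun u hu w hw h h' => (hln u hu).eq_of_mem (hln w hw) (hye u hu) (hyu u hu) (heu u hu)
        (h ▸ hyu w hw) (h' ▸ heu w hw)) h1 h2 h3
  by_cases hd : det3 a b c = 0
  · obtain ⟨x₀, hx₀⟩ := Finset.card_pos.mp (show 0 < S₁.card by omega)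
    obtain ⟨y₀, hy₀⟩ := Finset.card_pos.mp (show 0 < S₂.card by omega)
    obtain ⟨p1, p2, p3⟩ := hS₁ x₀ hx₀
    obtain ⟨q1, q2, q3⟩ := hS₂ y₀ hy₀
    set g : Fin 3 → ℝ := ![a 1 * b 2 - a 2 * b 1, a 2 * b 0 - a 0 * b 2, a 0 * b 1 - a 1 * b 0]
      with hg
    have hdg : det3 a b g ≠ 0 := by
      intro h0
      have hs : det3 a b g = (a 1 * b 2 - a 2 * b 1) ^ 2 + (a 2 * b 0 - a 0 * b 2) ^ 2 +
          (a 0 * b 1 - a 1 * b 0) ^ 2 := by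
        simp only [det3, hg, Matrix.cons_val]; ring
      rw [hs] at h0
      have z1 : a 1 * b 2 - a 2 * b 1 = 0 := by
        refine pow_eq_zero_iff two_ne_zero |>.mp ?_
        nlinarith [sq_nonneg (a 1 * b 2 - a 2 * b 1), sq_nonneg (a 2 * b 0 - a 0 * b 2),
          sq_nonneg (a 0 * b 1 - a 1 * b 0)]
      have z2 : a 2 * b 0 - a 0 * b 2 = 0 := by
        refine pow_eq_zero_iff two_ne_zero |>.mp ?_
        nlinarith [sq_nonneg (a 1 * b 2 - a 2 * b 1), sq_nonneg (a 2 * b 0 - a 0 * b 2),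
          sq_nonneg (a 0 * b 1 - a 1 * b 0)]
      have z3 : a 0 * b 1 - a 1 * b 0 = 0 := by
        refine pow_eq_zero_iff two_ne_zero |>.mp ?_
        nlinarith [sq_nonneg (a 1 * b 2 - a 2 * b 1), sq_nonneg (a 2 * b 0 - a 0 * b 2),
          sq_nonneg (a 0 * b 1 - a 1 * b 0)]
      have w0 : aff b x₀ * a 0 = 0 := by
        simp only [aff] at p1 ⊢; linear_combination b 0 * p1 + x₀.2 * z3 - z2
      have w1 : aff b x₀ * a 1 = 0 := by
        simp only [aff] at p1 ⊢; linear_combination b 1 * p1 - x₀.1 * z3 + z1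
      exact ha.elim (fun h => h ((mul_eq_zero.mp w0).resolve_left p2))
        fun h => h ((mul_eq_zero.mp w1).resolve_left p2)
    set k := -(aff a y₀ * aff c x₀) / (aff b x₀ * aff c y₀) with hk
    have hk0 : k ≠ 0 := div_ne_zero (neg_ne_zero.mpr (mul_ne_zero q1 p3)) (mul_ne_zero p2 q3)
    have hke : ∀ E ∈ S₃, aff a E = k * aff b E := fun E hE => by
      have := det3_mul_det3pt a b c x₀ y₀ E
      rw [hd, p1, q2, (hS₃ E hE).2.2] at this
      rw [hk]
      field_simp
      linear_combination -this
    refine main (fun P => aff g P / aff b P) (fun P => -k * (aff g P / aff a P)) ?_ ?_ ?_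
    · have hconst : ∀ u ∈ L, aff g (x u) / aff b (x u) - -k * (aff g (y u) / aff a (y u)) =
          aff g (e u) / aff b (e u) := fun u hu => by
        obtain ⟨x1, x2, x3⟩ := hS₁ _ (hxS u hu)
        obtain ⟨y1, y2, y3⟩ := hS₂ _ (hyS u hu)
        obtain ⟨e1, e2, e3⟩ := hS₃ _ (heS u hu)
        have := det3_mul_det3pt a b g (x u) (y u) (e u)
        rw [hcol u hu, x1, y2, hke _ (heS u hu)] at this
        field_simp
        have h' : aff b (e u) * (aff g (x u) * aff a (y u) * aff b (e u) +
          k * aff b (x u) * aff g (y u) * aff b (e u) - aff b (x u) * aff a (y u) * aff g (e u)) = 0 := by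
          linear_combination - aff b (e u) * this
        have := (mul_eq_zero.mp h').resolve_left e2
        linear_combination this
      intro u hu w hw huw
      have h1 := hconst u hu
      have h2 := hconst w hw
      rw [huw] at h1
      constructor <;> intro h <;> linarith
    · refine fun F hF h => card_le_two_of_inj (q := fun P => aff g P / aff b P) ?_ hF h
      intro P hP Q hQ hPQ
      obtain ⟨P1, P2, P3⟩ := hS₁ P hP
      obtain ⟨Q1, Q2, Q3⟩ := hS₁ Q hQ
      exact eq_of_ratio (b := g) (c := b) (fun h => hdg (by rw [det3_swap, h, neg_zero])) P1 Q1 P2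
        ((div_eq_div_iff P2 Q2).mp hPQ)
    · refine fun F hF h => card_le_two_of_inj (q := fun P => -k * (aff g P / aff a P)) ?_ hF h
      intro P hP Q hQ hPQ
      obtain ⟨P1, P2, P3⟩ := hS₂ P hP
      obtain ⟨Q1, Q2, Q3⟩ := hS₂ Q hQ
      exact eq_of_ratio (b := g) (c := a) (fun h => hdg (by rw [det3_rotate, h])) P2 Q2 P1
        ((div_eq_div_iff P1 Q1).mp (mul_left_cancel₀ (neg_ne_zero.mpr hk0) hPQ))
  · refine main (fun P => |aff b P / aff c P|) (fun P => |aff a P / aff c P|) ?_ ?_ ?_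
    · have hconst : ∀ u ∈ L, |aff a (e u) / aff b (e u)| * |aff b (x u) / aff c (x u)| =
          |aff a (y u) / aff c (y u)| := fun u hu => by
        obtain ⟨x1, x2, x3⟩ := hS₁ _ (hxS u hu)
        obtain ⟨y1, y2, y3⟩ := hS₂ _ (hyS u hu)
        obtain ⟨e1, e2, e3⟩ := hS₃ _ (heS u hu)
        have := det3_mul_det3pt a b c (x u) (y u) (e u)
        rw [hcol u hu, x1, y2, e3] at this
        rw [← abs_mul, ← abs_neg (aff a (y u) / aff c (y u))]
        congr 1
        field_simp
        linear_combination -this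
      intro u hu w hw huw
      obtain ⟨e1, e2, e3⟩ := hS₃ _ (heS u hu)
      have hpos : 0 < |aff a (e u) / aff b (e u)| := abs_pos.mpr (div_ne_zero e1 e2)
      have h2 := hconst w hw
      rw [← huw] at h2
      rw [← hconst u hu, ← h2, mul_le_mul_iff_right₀ hpos]
    · refine fun F hF h => card_le_two_of_abs (q := fun P => aff b P / aff c P) ?_ hF h
      intro P hP Q hQ hPQ
      obtain ⟨P1, P2, P3⟩ := hS₁ P hP
      obtain ⟨Q1, Q2, Q3⟩ := hS₁ Q hQ
      exact eq_of_ratio hd P1 Q1 P3 ((div_eq_div_iff P3 Q3).mp hPQ)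
    · refine fun F hF h => card_le_two_of_abs (q := fun P => aff a P / aff c P) ?_ hF h
      intro P hP Q hQ hPQ
      obtain ⟨P1, P2, P3⟩ := hS₂ P hP
      obtain ⟨Q1, Q2, Q3⟩ := hS₂ Q hQ
      exact eq_of_ratio (a := b) (b := a) (fun h => hd (by
        rw [det3_rotate, det3_swap, h, neg_zero])) P2 Q2 P3 ((div_eq_div_iff P3 Q3).mp hPQ)

end ThreeLines

section Pencils
open scoped Classical

variable {X : Finset (ℝ × ℝ)} {us : ℝ × ℝ → Finset (Set (ℝ × ℝ))} {t : Finset (Set (ℝ × ℝ))}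
  {V M : Fin 3 → ℝ × ℝ} {m : Fin 3 → Set (ℝ × ℝ)} {Z : ℝ × ℝ}

/-- The lines joining `Z` to the other points of `X`. -/
noncomputable def pencil (X : Finset (ℝ × ℝ)) (Z : ℝ × ℝ) : Finset (Set (ℝ × ℝ)) :=
  (X.erase Z).image (join Z)

lemma isLn_of_mem_pencil {u : Set (ℝ × ℝ)} (hu : u ∈ pencil X Z) : IsLn u ∧ Z ∈ u := by
  obtain ⟨W, hW, rfl⟩ := Finset.mem_image.mp hu
  exact ⟨isLn_join (Finset.ne_of_mem_erase hW).symm, left_mem_join _ _⟩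

lemma mem_pencil {u : Set (ℝ × ℝ)} (hu : IsLn u) (hZ : Z ∈ u) {W : ℝ × ℝ} (hW : W ∈ X)
    (hne : W ≠ Z) (hWu : W ∈ u) : u ∈ pencil X Z :=
  Finset.mem_image.mpr ⟨W, Finset.mem_erase.mpr ⟨hne, hW⟩, (hu.eq_join hne.symm hZ hWu).symm⟩

lemma sum_card_nod_pencil {S : Finset (ℝ × ℝ)} (hS : S ⊆ X.erase Z) :
    ∑ u ∈ pencil X Z, (nod S u).card = S.card := by
  have h := Finset.sum_card_bipartiteAbove_eq_sum_card_bipartiteBelow (s := pencil X Z) (t := S)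
    (fun u P => P ∈ u)
  simp only [Finset.bipartiteAbove, Finset.bipartiteBelow] at h
  simp only [nod, h]
  rw [Finset.sum_congr rfl (g := fun _ => 1), Finset.sum_const, smul_eq_mul, mul_one]
  intro P hP
  obtain ⟨hne, hPX⟩ := Finset.mem_erase.mp (hS hP)
  refine Finset.card_eq_one.mpr ⟨join Z P, ?_⟩
  ext u
  simp only [Finset.mem_filter, Finset.mem_singleton]
  constructor
  · rintro ⟨hu, hPu⟩
    obtain ⟨hu, hZu⟩ := isLn_of_mem_pencil hu
    exact hu.eq_join hne.symm hZu hPu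
  · rintro rfl
    exact ⟨Finset.mem_image_of_mem _ (hS hP), right_mem_join _ _⟩

lemma Config.mem_pencil (h : Config X us) {D : ℝ × ℝ} (hD : D ∈ X) {u : Set (ℝ × ℝ)}
    (hu : u ∈ us D) (hZu : Z ∈ u) : u ∈ pencil X Z := by
  obtain ⟨W, hW, hne⟩ := Finset.exists_mem_ne (h.two_le hD hu) Z
  exact _root_.mem_pencil (h.line D hD u hu) hZu (mem_nod.mp hW).1 hne (mem_nod.mp hW).2

lemma Config.sum_card_pencil (h : Config X us) (S : Finset (ℝ × ℝ)) :
    ∑ u ∈ pencil X Z, (usr X us u ∩ S).card =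
      ∑ D ∈ X ∩ S, ((us D).filter (Z ∈ ·)).card := by
  have e1 : ∀ u, usr X us u ∩ S = (X ∩ S).filter (u ∈ us ·) := fun u => by
    ext P; simp only [Finset.mem_inter, mem_usr, Finset.mem_filter]; tauto
  have h' := Finset.sum_card_bipartiteAbove_eq_sum_card_bipartiteBelow (s := pencil X Z)
    (t := X ∩ S) (fun u D => u ∈ us D)
  simp only [Finset.bipartiteAbove, Finset.bipartiteBelow] at h'
  simp only [e1, h']
  refine Finset.sum_congr rfl fun D hD => congrArg _ ?_
  have hDX := (Finset.mem_inter.mp hD).1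
  ext u
  simp only [Finset.mem_filter]
  exact ⟨fun ⟨h1, h2⟩ => ⟨h2, (isLn_of_mem_pencil h1).2⟩,
    fun ⟨h1, h2⟩ => ⟨h.mem_pencil hDX h1 h2, h1⟩⟩

lemma Config.card_filter_us_pos (h : Config X us) (hZ : Z ∈ X) {D : ℝ × ℝ} (hD : D ∈ X)
    (hne : Z ≠ D) : 1 ≤ ((us D).filter (Z ∈ ·)).card := by
  obtain ⟨u, hu, hZu⟩ := h.cover D hD Z hZ hne
  exact Finset.card_pos.mpr ⟨u, Finset.mem_filter.mpr ⟨hu, hZu⟩⟩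

lemma Config.card_le_sum_pencil (h : Config X us) (hZ : Z ∈ X) {S : Finset (ℝ × ℝ)}
    (hS : S ⊆ X.erase Z) : S.card ≤ ∑ u ∈ pencil X Z, (usr X us u ∩ S).card := by
  rw [h.sum_card_pencil, Finset.inter_eq_right.mpr (hS.trans (Finset.erase_subset _ _)),
    Finset.card_eq_sum_ones]
  refine Finset.sum_le_sum fun D hD => ?_
  obtain ⟨hne, hDX⟩ := Finset.mem_erase.mp (hS hD)
  exact h.card_filter_us_pos hZ hDX hne.symm

lemma IsT.card_le_of_three (ht : IsT X t) {L : Finset (Set (ℝ × ℝ))}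
    (hL : ∀ u ∈ L, IsLn u ∧ u ∉ t ∧ (nod (X \ rest X t) u).card = 3) : L.card ≤ 19 := by
  have hmeet : ∀ u ∈ L, ∀ l ∈ t, ∃ P ∈ nod X l, P ∈ u := fun u hu l hl => by
    obtain ⟨hul, hut, hu3⟩ := hL u hu
    by_contra! hn
    have := card_le_card_of_cover (s := t.erase l) (S := nod (X \ rest X t) u)
      (fun v hv => ht.line v (Finset.mem_of_mem_erase hv)) hul
      (fun hv => hut (Finset.mem_of_mem_erase hv)) (fun P hP => (mem_nod.mp hP).2) fun P hP => by
        obtain ⟨hP, hPu⟩ := mem_nod.mp hP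
        obtain ⟨hPX, hPr⟩ := Finset.mem_sdiff.mp hP
        obtain ⟨v, hv, hPv⟩ := exists_line_of_notMem_rest hPX hPr
        exact ⟨v, Finset.mem_erase.mpr ⟨fun e => hn P (mem_nod.mpr ⟨hPX, e ▸ hPv⟩) hPu, hv⟩, hPv⟩
    rw [Finset.card_erase_of_mem hl, ht.card] at this
    omega
  obtain ⟨a, b, c, hab, hac, hbc, rfl⟩ := Finset.card_eq_three.mp ht.card
  have ha : a ∈ ({a, b, c} : Finset (Set (ℝ × ℝ))) := by simp
  have hb : b ∈ ({a, b, c} : Finset (Set (ℝ × ℝ))) := by simp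
  have hc : c ∈ ({a, b, c} : Finset (Set (ℝ × ℝ))) := by simp
  exact card_trisecants_le (ht.line a ha) (ht.line b hb) (ht.line c hc)
    (ht.five a ha) (ht.five b hb) (ht.five c hc)
    (fun P hP => ⟨(mem_nod.mp hP).2, ht.disj a ha b hb hab P (mem_nod.mp hP).1 (mem_nod.mp hP).2,
      ht.disj a ha c hc hac P (mem_nod.mp hP).1 (mem_nod.mp hP).2⟩)
    (fun P hP => ⟨ht.disj b hb a ha hab.symm P (mem_nod.mp hP).1 (mem_nod.mp hP).2,
      (mem_nod.mp hP).2, ht.disj b hb c hc hbc P (mem_nod.mp hP).1 (mem_nod.mp hP).2⟩)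
    (fun P hP => ⟨ht.disj c hc a ha hac.symm P (mem_nod.mp hP).1 (mem_nod.mp hP).2,
      ht.disj c hc b hb hbc.symm P (mem_nod.mp hP).1 (mem_nod.mp hP).2, (mem_nod.mp hP).2⟩)
    fun u hu => ⟨(hL u hu).1, hmeet u hu a ha, hmeet u hu b hb, hmeet u hu c hc⟩

lemma Config.usr_sdiff_eq_empty (h : Config X us) (ht : IsT X t) {u : Set (ℝ × ℝ)}
    (ha : (nod (X \ rest X t) u).card ≤ 1) : (usr X us u ∩ (X \ rest X t)).card = 0 := by
  by_contra hn
  obtain ⟨D, hD⟩ := Finset.card_pos.mp (Nat.pos_of_ne_zero hn)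
  obtain ⟨hDu, hDr⟩ := Finset.mem_inter.mp hD
  obtain ⟨hDX, hDu⟩ := mem_usr.mp hDu
  obtain ⟨l, hl, hDl⟩ := exists_line_of_notMem_rest hDX (Finset.mem_sdiff.mp hDr).2
  have hc : 1 < (t.erase l).card := by rw [Finset.card_erase_of_mem hl, ht.card]; omega
  obtain ⟨l', hl', l'', hl'', hne⟩ := Finset.one_lt_card.mp hc
  obtain ⟨n', hl'⟩ := Finset.mem_erase.mp hl'
  obtain ⟨n'', hl''⟩ := Finset.mem_erase.mp hl''
  obtain ⟨P, hP, hPl, hPu⟩ := h.exists_mem_of_mem_us ht hDX hl hDl hl' n' hDu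
  obtain ⟨Q, hQ, hQl, hQu⟩ := h.exists_mem_of_mem_us ht hDX hl hDl hl'' n'' hDu
  have hPQ : P ≠ Q := fun e => ht.disj l' hl' l'' hl'' hne P hP hPl (e ▸ hQl)
  have hm : ∀ R ∈ X, R ∈ u → ∀ v ∈ t, R ∈ v → R ∈ nod (X \ rest X t) u := fun R hR hRu v hv hRv =>
    mem_nod.mpr ⟨Finset.mem_sdiff.mpr ⟨hR, fun h' => (mem_rest.mp h').2 v hv hRv⟩, hRu⟩
  have := Finset.one_lt_card.mpr ⟨P, hm P hP hPu l' hl' hPl, Q, hm Q hQ hQu l'' hl'' hQl, hPQ⟩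
  omega

lemma Config.user_bounds (h : Config X us) (ht : IsT X t) {u : Set (ℝ × ℝ)} (hu : IsLn u)
    (hut : u ∉ t) {a b d y : ℕ} (ha : (nod (X \ rest X t) u).card = a)
    (hb : (nod (rest X t) u).card = b) (hd : (usr X us u ∩ (X \ rest X t)).card = d)
    (hy : (usr X us u ∩ rest X t).card = y) :
    a ≤ 3 ∧ b ≤ 3 ∧ a + b ≤ 5 ∧ (a + b = 5 → d + y ≤ 4) ∧ (a + b = 4 → d + y ≤ 3) ∧
      (a + b ≤ 3 → d ≤ 1) ∧ (a ≤ 1 → d = 0) ∧ (b = 3 → 3 ≤ y) := by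
  have e := card_nod_rest_add (X := X) t u
  have e' : (usr X us u).card = d + y := by
    rw [← hd, ← hy, ← Finset.card_union_of_disjoint]
    · congr 1; ext P
      simp only [Finset.mem_union, Finset.mem_inter, Finset.mem_sdiff, mem_usr]; tauto
    · exact Finset.disjoint_left.mpr fun P h1 h2 =>
        (Finset.mem_sdiff.mp (Finset.mem_inter.mp h1).2).2 (Finset.mem_inter.mp h2).2
  have h1 := ht.card_nod_sdiff_le hu hut
  have h2 := h.card_nod_rest_le ht hu
  have h3 := h.le5 u hu
  refine ⟨by omega, by omega, by omega, fun hk => ?_, fun hk => ?_, fun hk => ?_, fun hk => ?_,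
    fun hk => ?_⟩
  · by_contra! hlt
    obtain ⟨t', ht', hut'⟩ := h.exists_isT_of_five hu (by omega) (by omega)
    exact hut (h.isT_unique ht ht' ▸ hut')
  · rw [← e']
    exact h.card_usr_le_of_four (by omega)
  · by_contra! hlt
    obtain ⟨A, hA, B, hB, hAB⟩ := Finset.one_lt_card.mp (hd ▸ hlt)
    obtain ⟨hA, hAr⟩ := Finset.mem_inter.mp hA
    obtain ⟨-, t', ht', hsub, -⟩ := h.two_users (by omega) hAB hA (Finset.mem_inter.mp hB).1
    rw [h.isT_unique ht ht'] at hsub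
    obtain ⟨l, hl⟩ := Finset.card_pos.mp (show 0 < t.card by rw [ht.card]; omega)
    exact (Finset.mem_sdiff.mp hAr).2
      (h.usr_eq_rest ht hl ▸ mem_usr.mpr ⟨(mem_usr.mp hA).1, hsub hl⟩)
  · rw [← hd]
    exact h.usr_sdiff_eq_empty ht (by omega)
  · rw [← hy]
    exact h.three_le_users ht hu (by omega)

end Pencils

section Exclusion
open scoped Classical

variable {X : Finset (ℝ × ℝ)} {us : ℝ × ℝ → Finset (Set (ℝ × ℝ))} {t : Finset (Set (ℝ × ℝ))}
  {Y : Finset (ℝ × ℝ)} {V M : Fin 3 → ℝ × ℝ} {m : Fin 3 → Set (ℝ × ℝ)} {Z : ℝ × ℝ}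

lemma three_le_card_nod {S : Finset (ℝ × ℝ)} {u : Set (ℝ × ℝ)} {P Q R : ℝ × ℝ} (hP : P ∈ S)
    (hQ : Q ∈ S) (hR : R ∈ S) (hPu : P ∈ u) (hQu : Q ∈ u) (hRu : R ∈ u) (hPQ : P ≠ Q) (hPR : P ≠ R)
    (hQR : Q ≠ R) : 3 ≤ (nod S u).card :=
  Finset.two_lt_card_iff.mpr ⟨P, Q, R, mem_nod.mpr ⟨hP, hPu⟩, mem_nod.mpr ⟨hQ, hQu⟩,
    mem_nod.mpr ⟨hR, hRu⟩, hPQ, hPR, hQR⟩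

lemma Six.eq_of_V_mem (s : Six Y V M m) {u : Set (ℝ × ℝ)} (hu : IsLn u)
    (h2 : (nod Y u).card = 2) {i : Fin 3} (hi : V i ∈ u) : u = join (V i) (M i) := by
  rcases s.classify hu h2.ge with ⟨j, rfl⟩ | ⟨j, hV, hM⟩ | ⟨j, rfl⟩
  · have := s.three_le j
    omega
  · by_cases hij : i = j
    · subst hij
      exact hu.eq_join (s.V_ne_M _ _) hV hM
    · have := three_le_card_nod (s.V_mem i) (s.V_mem j) (s.M_mem j) hi hV hM
        (s.V_injective.ne hij) (s.V_ne_M _ _) (s.V_ne_M _ _)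
      omega
  · have := three_le_card_nod (s.V_mem i) (s.M_mem (j + 1)) (s.M_mem (j + 2)) hi
      (left_mem_join _ _) (right_mem_join _ _) (s.V_ne_M _ _) (s.V_ne_M _ _)
      (s.M_injective.ne ((by decide : ∀ j : Fin 3, j + 1 ≠ j + 2) j))
    omega

lemma Six.eq_of_M_mem (s : Six Y V M m) {u : Set (ℝ × ℝ)} (hu : IsLn u)
    (h2 : (nod Y u).card = 2) {i : Fin 3} (hi : M i ∈ u) : u = join (V i) (M i) ∨
      ((u = join (M i) (M (i + 1)) ∨ u = join (M (i + 2)) (M i)) ∧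
        ∃ j, u = join (M (j + 1)) (M (j + 2))) := by
  rcases s.classify hu h2.ge with ⟨j, rfl⟩ | ⟨j, hV, hM⟩ | ⟨j, rfl⟩
  · have := s.three_le j
    omega
  · by_cases hij : i = j
    · subst hij
      exact .inl (hu.eq_join (s.V_ne_M _ _) hV hM)
    · have := three_le_card_nod (s.M_mem i) (s.V_mem j) (s.M_mem j) hi hV hM
        (s.V_ne_M _ _).symm (s.M_injective.ne hij) (s.V_ne_M _ _)
      omega
  · refine .inr ⟨?_, j, rfl⟩
    by_cases h1 : i = j + 1
    · subst h1
      exact .inl (by rw [(by decide : ∀ j : Fin 3, j + 1 + 1 = j + 2) j])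
    by_cases h2' : i = j + 2
    · subst h2'
      exact .inr (by rw [(by decide : ∀ j : Fin 3, j + 2 + 2 = j + 1) j])
    have := three_le_card_nod (s.M_mem i) (s.M_mem (j + 1)) (s.M_mem (j + 2)) hi
      (left_mem_join _ _) (right_mem_join _ _) (s.M_injective.ne h1) (s.M_injective.ne h2')
      (s.M_injective.ne ((by decide : ∀ j : Fin 3, j + 1 ≠ j + 2) j))
    omega

/-- The indicator of lines with `k` points in `rest X t` and three other nodes. -/
noncomputable def ind (X : Finset (ℝ × ℝ)) (t : Finset (Set (ℝ × ℝ))) (k : ℕ)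
    (u : Set (ℝ × ℝ)) : ℕ :=
  if (nod (X \ rest X t) u).card = 3 ∧ (nod (rest X t) u).card = k then 1 else 0

lemma notMem_of_mem_rest (hZ : Z ∈ rest X t) {u : Set (ℝ × ℝ)} (hZu : Z ∈ u) : u ∉ t :=
  fun hut => (mem_rest.mp hZ).2 u hut hZu

lemma sum_ite_le (P : Finset (Set (ℝ × ℝ))) (D : Set (ℝ × ℝ)) (k : ℕ) :
    ∑ u ∈ P, (if u = D then k else 0) ≤ k := by
  rw [Finset.sum_ite_eq']
  split_ifs <;> omega

lemma Config.fifteen_le (h : Config X us) (ht : IsT X t) (hZ : Z ∈ rest X t)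
    {g : Set (ℝ × ℝ) → ℕ} (hg : ∀ u, IsLn u → Z ∈ u →
      2 * (usr X us u ∩ (X \ rest X t)).card ≤ (nod (X \ rest X t) u).card + g u) :
    15 ≤ ∑ u ∈ pencil X Z, g u := by
  have hS : X \ rest X t ⊆ X.erase Z := fun P hP => by
    obtain ⟨h1, h2⟩ := Finset.mem_sdiff.mp hP
    exact Finset.mem_erase.mpr ⟨fun e => h2 (e ▸ hZ), h1⟩
  have h1 := sum_card_nod_pencil hS
  have h2 := h.card_le_sum_pencil (rest_subset hZ) hS
  have h3 : (X \ rest X t).card = 15 := by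
    rw [Finset.card_sdiff_of_subset rest_subset, h.card_rest ht, h.card]
  have h4 := Finset.sum_le_sum fun u (hu : u ∈ pencil X Z) =>
    hg u (isLn_of_mem_pencil hu).1 (isLn_of_mem_pencil hu).2
  rw [Finset.sum_add_distrib, ← Finset.mul_sum] at h4
  omega

lemma one_le_card_nod {S : Finset (ℝ × ℝ)} (hZ : Z ∈ S) {u : Set (ℝ × ℝ)} (hZu : Z ∈ u) :
    1 ≤ (nod S u).card := Finset.card_pos.mpr ⟨Z, mem_nod.mpr ⟨hZ, hZu⟩⟩

lemma Config.eight_le (h : Config X us) (ht : IsT X t) (s : Six (rest X t) V M m) (i : Fin 3) :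
    8 ≤ ∑ u ∈ pencil X (V i), (2 * ind X t 1 u + ind X t 2 u) := by
  have hZ := s.V_mem i
  have h1 := h.fifteen_le ht hZ
    (g := fun u => 3 * ind X t 1 u + if u = join (V i) (M i) then 5 else 0) fun u hu hZu => by
      have hb := h.user_bounds ht hu (notMem_of_mem_rest hZ hZu) rfl rfl rfl rfl
      have hb1 := one_le_card_nod hZ hZu
      have hb2 := fun hc => s.eq_of_V_mem hu hc hZu
      simp only [ind]
      split_ifs with c1 c2 c2
      · omega
      · omega
      · omega
      · have : (nod (rest X t) u).card ≠ 2 := fun hc => c2 (hb2 hc)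
        omega
  have h2 := sum_ite_le (pencil X (V i)) (join (V i) (M i)) 5
  rw [Finset.sum_add_distrib, ← Finset.mul_sum] at h1 ⊢
  omega

lemma Config.five_le (h : Config X us) (ht : IsT X t) (s : Six (rest X t) V M m) (i : Fin 3) :
    5 ≤ ∑ u ∈ pencil X (M i), (2 * ind X t 1 u + ind X t 2 u) := by
  have hZ := s.M_mem i
  have hy : ∀ j, 1 ≤ (usr X us (join (M (j + 1)) (M (j + 2))) ∩ rest X t).card := fun j =>
    Finset.card_pos.mpr ⟨V j, Finset.mem_inter.mpr
      ⟨mem_usr.mpr ⟨rest_subset (s.V_mem j), s.join_mem_us h ht j⟩, s.V_mem j⟩⟩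
  have hc : ∀ u, IsLn u → M i ∈ u → (nod (rest X t) u).card = 2 → u = join (V i) (M i) ∨
      ((u = join (M i) (M (i + 1)) ∨ u = join (M (i + 2)) (M i)) ∧
        1 ≤ (usr X us u ∩ rest X t).card) := fun u hu hZu h2 => by
    rcases s.eq_of_M_mem hu h2 hZu with hD | ⟨hE, j, hj⟩
    exacts [.inl hD, .inr ⟨hE, hj ▸ hy j⟩]
  have h1 := h.fifteen_le ht hZ
    (g := fun u => 3 * ind X t 1 u + ind X t 2 u + (if u = join (V i) (M i) then 4 else 0) +
      (if u = join (M i) (M (i + 1)) then 2 else 0) +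
        if u = join (M (i + 2)) (M i) then 2 else 0) fun u hu hZu => by
      have hb := h.user_bounds ht hu (notMem_of_mem_rest hZ hZu) rfl rfl rfl rfl
      have hb1 := one_le_card_nod hZ hZu
      have hb2 := hc u hu hZu
      simp only [ind]
      by_cases c2 : (nod (rest X t) u).card = 2
      · rcases hb2 c2 with hD | ⟨hE | hE, hy⟩
        · rw [if_pos hD]
          by_cases c3 : (nod (X \ rest X t) u).card = 3
          · rw [if_pos (⟨c3, c2⟩ : _ ∧ _)]
            omega
          · omega
        · rw [if_pos hE]
          by_cases c3 : (nod (X \ rest X t) u).card = 3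
          · rw [if_pos (⟨c3, c2⟩ : _ ∧ _)]
            omega
          · omega
        · rw [if_pos hE]
          by_cases c3 : (nod (X \ rest X t) u).card = 3
          · rw [if_pos (⟨c3, c2⟩ : _ ∧ _)]
            omega
          · omega
      · by_cases c1 : (nod (X \ rest X t) u).card = 3 ∧ (nod (rest X t) u).card = 1
        · rw [if_pos c1]
          omega
        · omega
  have h3 : ∑ u ∈ pencil X (M i), ind X t 2 u ≤ ∑ u ∈ pencil X (M i),
      ((if u = join (V i) (M i) then 1 else 0) + (if u = join (M i) (M (i + 1)) then 1 else 0) +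
        if u = join (M (i + 2)) (M i) then 1 else 0) := Finset.sum_le_sum fun u hu => by
    obtain ⟨hu, hZu⟩ := isLn_of_mem_pencil hu
    simp only [ind]
    by_cases c : (nod (X \ rest X t) u).card = 3 ∧ (nod (rest X t) u).card = 2
    · rw [if_pos c]
      rcases hc u hu hZu c.2 with hD | ⟨hE | hE, -⟩
      · rw [if_pos hD]; omega
      · rw [if_pos hE]; omega
      · rw [if_pos hE]; omega
    · rw [if_neg c]; omega
  have a1 := sum_ite_le (pencil X (M i)) (join (V i) (M i))
  have a2 := sum_ite_le (pencil X (M i)) (join (M i) (M (i + 1)))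
  have a3 := sum_ite_le (pencil X (M i)) (join (M (i + 2)) (M i))
  have := a1 1
  have := a2 1
  have := a3 1
  have := a1 4
  have := a2 2
  have := a3 2
  simp only [Finset.sum_add_distrib, ← Finset.mul_sum] at h1 h3 ⊢
  omega

lemma Config.not_isT (h : Config X us) : ¬IsT X t := by
  intro ht
  obtain ⟨V, M, m, s⟩ := h.exists_six ht
  set L := ((rest X t).biUnion (pencil X)).filter fun u => (nod (X \ rest X t) u).card = 3 with hL
  have hL19 : L.card ≤ 19 := ht.card_le_of_three fun u hu => by
    obtain ⟨hu, hu3⟩ := Finset.mem_filter.mp hu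
    obtain ⟨Z, hZ, hu⟩ := Finset.mem_biUnion.mp hu
    obtain ⟨hu, hZu⟩ := isLn_of_mem_pencil hu
    exact ⟨hu, notMem_of_mem_rest hZ hZu, hu3⟩
  set w : Set (ℝ × ℝ) → ℕ := fun u => 2 * ind X t 1 u + ind X t 2 u with hw
  have hpen : ∀ Z ∈ rest X t, ∑ u ∈ pencil X Z, w u ≤ ∑ u ∈ L, if Z ∈ u then w u else 0 := by
    intro Z hZ
    rw [← Finset.sum_filter]
    refine Finset.sum_le_sum_of_ne_zero fun u hu hwu => ?_
    refine Finset.mem_filter.mpr ⟨Finset.mem_filter.mpr ⟨Finset.mem_biUnion.mpr ⟨Z, hZ, hu⟩, ?_⟩,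
      (isLn_of_mem_pencil hu).2⟩
    by_contra hn
    simp [hw, ind, hn] at hwu
  have hupper : ∑ Z ∈ rest X t, ∑ u ∈ pencil X Z, w u ≤ 2 * L.card := by
    refine (Finset.sum_le_sum hpen).trans ?_
    rw [Finset.sum_comm, mul_comm, ← smul_eq_mul, ← Finset.sum_const]
    refine Finset.sum_le_sum fun u _ => ?_
    rw [← Finset.sum_filter, Finset.sum_const, smul_eq_mul]
    change (nod (rest X t) u).card * _ ≤ 2
    simp only [hw, ind]
    by_cases c1 : (nod (rest X t) u).card = 1
    · rw [c1]; split_ifs <;> omega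
    by_cases c2 : (nod (rest X t) u).card = 2
    · rw [c2]; split_ifs <;> omega
    simp [c1, c2]
  have hY : rest X t = Finset.univ.image V ∪ Finset.univ.image M := by
    ext P
    simp only [s.mem, Finset.mem_union, Finset.mem_image, Finset.mem_univ, true_and, eq_comm]
  have hdis : Disjoint (Finset.univ.image V) (Finset.univ.image M) := by
    refine Finset.disjoint_left.mpr fun P h1 h2 => ?_
    obtain ⟨i, -, rfl⟩ := Finset.mem_image.mp h1
    obtain ⟨j, -, hj⟩ := Finset.mem_image.mp h2
    exact s.V_ne_M i j hj.symm
  rw [hY, Finset.sum_union hdis, Finset.sum_image s.V_injective.injOn,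
    Finset.sum_image s.M_injective.injOn] at hupper
  have hV := Finset.sum_le_sum fun i (_ : i ∈ (Finset.univ : Finset (Fin 3))) => h.eight_le ht s i
  have hM := Finset.sum_le_sum fun i (_ : i ∈ (Finset.univ : Finset (Fin 3))) => h.five_le ht s i
  simp only [Finset.sum_const, Finset.card_univ, Fintype.card_fin, smul_eq_mul] at hV hM
  simp only [hw] at hupper
  omega

end Exclusion

section Final
open scoped Classical

variable {X : Finset (ℝ × ℝ)} {us : ℝ × ℝ → Finset (Set (ℝ × ℝ))} {A Z : ℝ × ℝ}

lemma card_nod_erase (hZ : Z ∈ X) {u : Set (ℝ × ℝ)} (hZu : Z ∈ u) :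
    (nod (X.erase Z) u).card + 1 = (nod X u).card := by
  have : nod (X.erase Z) u = (nod X u).erase Z := by
    ext P; simp only [mem_nod, Finset.mem_erase]; tauto
  rw [this, Finset.card_erase_add_one (mem_nod.mpr ⟨hZ, hZu⟩)]

lemma Config.card_usr_le (h : Config X us) {u : Set (ℝ × ℝ)} (hu : IsLn u) :
    ((nod X u).card = 5 → (usr X us u).card ≤ 4) ∧
      ((nod X u).card ≤ 3 → (usr X us u).card ≤ 1) := by
  constructor <;> intro hk <;> by_contra! hlt
  · obtain ⟨t, ht, -⟩ := h.exists_isT_of_five hu hk hlt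
    exact h.not_isT ht
  · obtain ⟨B, hB, C, hC, hBC⟩ := Finset.one_lt_card.mp hlt
    obtain ⟨-, t, ht, -⟩ := h.two_users hk hBC hB hC
    exact h.not_isT ht

lemma Config.card_usr_le_nod (h : Config X us) (hZ : Z ∈ X) {u : Set (ℝ × ℝ)}
    (hu : u ∈ pencil X Z) : (usr X us u ∩ X.erase Z).card ≤ (nod (X.erase Z) u).card ∧
      ((nod X u).card = 3 → (usr X us u ∩ X.erase Z).card < (nod (X.erase Z) u).card) := by
  obtain ⟨hl, hZu⟩ := isLn_of_mem_pencil hu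
  have h1 := card_nod_erase hZ hZu
  obtain ⟨W, hW, rfl⟩ := Finset.mem_image.mp hu
  have h2 := one_le_card_nod hW (right_mem_join Z W)
  have h3 := h.card_usr_le hl
  have h4 := h.card_usr_le_of_four (u := join Z W)
  have h5 := h.le5 _ hl
  have h6 := Finset.card_le_card
    (Finset.inter_subset_left : usr X us (join Z W) ∩ X.erase Z ⊆ usr X us (join Z W))
  omega

lemma Config.card_filter_us_eq_one (h : Config X us) (hA : A ∈ X) (hZ : Z ∈ X) (hne : A ≠ Z) :
    ((us A).filter (Z ∈ ·)).card = 1 := by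
  have h1 := h.sum_card_pencil (Z := Z) (X.erase Z)
  rw [Finset.inter_eq_right.mpr (Finset.erase_subset _ _)] at h1
  have h2 := Finset.sum_le_sum fun u hu => (h.card_usr_le_nod hZ hu).1
  rw [h1, sum_card_nod_pencil subset_rfl, Finset.card_eq_sum_ones] at h2
  have h3 : ∀ D ∈ X.erase Z, 1 ≤ ((us D).filter (Z ∈ ·)).card := fun D hD =>
    h.card_filter_us_pos hZ (Finset.mem_of_mem_erase hD) (Finset.ne_of_mem_erase hD).symm
  exact ((Finset.sum_eq_sum_iff_of_le h3).mp (le_antisymm (Finset.sum_le_sum h3) h2) A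
    (Finset.mem_erase.mpr ⟨hne, hA⟩)).symm

lemma Config.card_nod_ne_three (h : Config X us) (hA : A ∈ X) {u : Set (ℝ × ℝ)} (hu : u ∈ us A) :
    (nod X u).card ≠ 3 := by
  intro h3
  obtain ⟨Z, hZ⟩ := Finset.card_pos.mp (show 0 < (nod X u).card by omega)
  obtain ⟨hZ, hZu⟩ := mem_nod.mp hZ
  have hup := h.mem_pencil hA hu hZu
  have h1 := Finset.sum_lt_sum (fun u hu => (h.card_usr_le_nod hZ hu).1)
    ⟨u, hup, (h.card_usr_le_nod hZ hup).2 h3⟩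
  have h2 := h.card_le_sum_pencil hZ subset_rfl
  rw [sum_card_nod_pencil subset_rfl] at h1
  exact absurd h2 (not_le.mpr h1)

lemma Config.card_residual_ne_three (h : Config X us) (hA : A ∈ X) {u : Set (ℝ × ℝ)}
    (hu : u ∈ us A) {s : Finset (Set (ℝ × ℝ))} (hs : s ⊆ (us A).erase u) :
    ((nod X u).filter fun P => ∀ v ∈ s, P ∉ v).card ≠ 3 := by
  have hf : ∀ P ∈ nod X u, ∀ v ∈ s, P ∉ v := fun P hP v hvs hPv => by
    obtain ⟨hP, hPu⟩ := mem_nod.mp hP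
    obtain ⟨hvu, hv⟩ := Finset.mem_erase.mp (hs hvs)
    have h1 := h.card_filter_us_eq_one hA hP fun e => h.avoid A hA u hu (e ▸ hPu)
    exact hvu (Finset.card_le_one.mp h1.le v (Finset.mem_filter.mpr ⟨hv, hPv⟩) u
      (Finset.mem_filter.mpr ⟨hu, hPu⟩))
  rw [Finset.filter_true_of_mem hf]
  exact h.card_nod_ne_three hA hu

end Final

section Bridge
open scoped Classical

lemma ev_mem_PF {n : ℕ} {p : MvPolynomial (Fin 2) ℝ} (hp : p.totalDegree ≤ n) : ev p ∈ PF n := by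
  have h : ev p = ∑ d ∈ p.support, p.coeff d • fun P : ℝ × ℝ => P.1 ^ d 0 * P.2 ^ d 1 := by
    ext P
    simp [ev, eval_eq', Fin.prod_univ_two]
  rw [h]
  refine Submodule.sum_mem _ fun d hd => Submodule.smul_mem _ _ (Submodule.subset_span
    ⟨d 0, d 1, ?_, rfl⟩)
  have := (le_totalDegree hd).trans hp
  rwa [Finsupp.sum_fintype _ _ fun _ => rfl, Fin.sum_univ_two] at this

lemma exists_aff_of_mem_PF_one {f : ℝ × ℝ → ℝ} (hf : f ∈ PF 1) : ∃ v, f = aff v := by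
  induction hf using Submodule.span_induction with
  | mem f hf =>
    obtain ⟨i, j, hij, rfl⟩ := hf
    obtain ⟨rfl, rfl⟩ | ⟨rfl, rfl⟩ | ⟨rfl, rfl⟩ :
      (i = 0 ∧ j = 0) ∨ (i = 1 ∧ j = 0) ∨ (i = 0 ∧ j = 1) := by omega
    · exact ⟨![0, 0, 1], by ext P; simp [aff]⟩
    · exact ⟨![1, 0, 0], by ext P; simp [aff]⟩
    · exact ⟨![0, 1, 0], by ext P; simp [aff]⟩
  | zero => exact ⟨0, by ext P; simp [aff]⟩
  | add f g _ _ hf hg =>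
    obtain ⟨v, rfl⟩ := hf
    obtain ⟨w, rfl⟩ := hg
    exact ⟨v + w, by ext P; simp only [aff, Pi.add_apply]; ring⟩
  | smul a f _ hf =>
    obtain ⟨v, rfl⟩ := hf
    exact ⟨a • v, by ext P; simp only [aff, Pi.smul_apply, smul_eq_mul]; ring⟩

lemma eq_of_ev_eq {p q : MvPolynomial (Fin 2) ℝ} (h : ev p = ev q) : p = q := by
  apply MvPolynomial.funext
  intro x
  have hx : x = ![x 0, x 1] := by ext i; fin_cases i <;> rfl
  rw [hx]
  exact congrFun h (x 0, x 1)

lemma IsLinePoly.isLn {l : MvPolynomial (Fin 2) ℝ} (hl : IsLinePoly l) : IsLn (lineSet l) := by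
  obtain ⟨v, hv⟩ := exists_aff_of_mem_PF_one (ev_mem_PF hl.le)
  refine ⟨v, ?_, by ext P; simp [lineSet, hv]⟩
  by_contra! h0
  have : l = C (v 2) := eq_of_ev_eq (by rw [hv]; ext P; simp [ev, aff, h0])
  rw [IsLinePoly, this, totalDegree_C] at hl
  exact zero_ne_one hl

lemma IsLn.exists_isLinePoly {u : Set (ℝ × ℝ)} (hu : IsLn u) :
    ∃ l, IsLinePoly l ∧ lineSet l = u := by
  obtain ⟨v, hv, rfl⟩ := hu
  obtain ⟨p, hp, hpv⟩ := exists_poly_of_mem_PF (aff_mem_PF v)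
  refine ⟨p, le_antisymm hp (Nat.one_le_iff_ne_zero.mpr fun h0 => ?_), by
    ext P; simp [lineSet, ev, hpv]⟩
  rw [totalDegree_eq_zero_iff_eq_C.mp h0] at hpv
  simp only [eval_C, aff] at hpv
  have h1 := hpv (0, 0)
  have h2 := hpv (1, 0)
  have h3 := hpv (0, 1)
  simp only at h1 h2 h3
  exact hv.elim (fun h => h (by linarith)) fun h => h (by linarith)

lemma ev_prod {n : ℕ} (f : Fin n → MvPolynomial (Fin 2) ℝ) (P : ℝ × ℝ) :
    ev (∏ i, f i) P = ∏ i, ev (f i) P := by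
  simp [ev, map_prod]

lemma GCSet.exists_config {X : Set (ℝ × ℝ)} (hX : GCSet 5 X) (hnm : NoMaximalLine 5 X) :
    ∃ us, Config hX.1.1.toFinset us := by
  have hP : ∀ f ∈ PF 5, (∀ P ∈ X, f P = 0) → f = 0 := fun f hf h0 => by
    obtain ⟨p, hp, hpf⟩ := exists_poly_of_mem_PF hf
    have := hX.1.2.2 p hp fun A hA => (hpf A).trans (h0 A hA)
    ext P
    rw [← hpf, this, map_zero, Pi.zero_apply]
  choose! p hp f hf hpf using hX.2
  set us : ℝ × ℝ → Finset (Set (ℝ × ℝ)) := fun A => Finset.univ.image fun i => lineSet (f A i)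
  have hus : ∀ {A u}, u ∈ us A ↔ ∃ i, lineSet (f A i) = u := by simp [us]
  have hline : ∀ A ∈ X, ∀ u ∈ us A, IsLn u := fun A hA u hu => by
    obtain ⟨i, rfl⟩ := hus.mp hu
    exact (hf A hA i).isLn
  have havoid : ∀ A ∈ X, ∀ u ∈ us A, A ∉ u := fun A hA u hu hAu => by
    obtain ⟨i, rfl⟩ := hus.mp hu
    have h1 := (hp A hA).2.1
    rw [hpf A hA, ev_prod] at h1
    have h2 : ev (f A i) A = 0 := hAu
    exact zero_ne_one ((Finset.prod_eq_zero (Finset.mem_univ i) h2).symm.trans h1)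
  have hcover : ∀ A ∈ X, ∀ B ∈ X, B ≠ A → ∃ u ∈ us A, B ∈ u := fun A hA B hB hBA => by
    have h1 := (hp A hA).2.2 B hB hBA
    rw [hpf A hA, ev_prod, Finset.prod_eq_zero_iff] at h1
    obtain ⟨i, -, hi⟩ := h1
    exact ⟨_, hus.mpr ⟨i, rfl⟩, hi⟩
  have hcard : ∀ A, (us A).card ≤ 5 := fun A => Finset.card_image_le.trans (by simp)
  refine ⟨us, ?_, ?_, fun A hA => le_antisymm (hcard A) ?_, ?_, ?_, fun u hu => ?_, ?_⟩
  · rw [← Set.ncard_eq_toFinset_card X hX.1.1, hX.1.2.1]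
  · simpa using hline
  · rw [Set.Finite.mem_toFinset] at hA
    by_contra! hlt
    have hne : A ≠ (A.1 + 1, A.2) := fun h => by simpa using congrArg Prod.fst h
    have hs : ∀ u ∈ insert (join A (A.1 + 1, A.2)) (us A), IsLn u := by
      intro u hu
      rcases Finset.mem_insert.mp hu with rfl | hu
      · exact isLn_join hne
      · exact hline A hA u hu
    obtain ⟨P, hPs⟩ := exists_notMem_lines hs
    have := hP _ (PF_mono ((Finset.card_insert_le _ _).trans hlt) (pr_mem_PF _)) fun B hB => by
      rw [pr_eq_zero_iff hs]
      by_cases hBA : B = A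
      · exact ⟨_, Finset.mem_insert_self _ _, hBA ▸ left_mem_join _ _⟩
      · obtain ⟨u, hu, hBu⟩ := hcover A hA B hB hBA
        exact ⟨u, Finset.mem_insert_of_mem hu, hBu⟩
    obtain ⟨u, hu, hPu⟩ := (pr_eq_zero_iff hs).mp (congrFun this P)
    exact hPs u hu hPu
  · simpa using havoid
  · simpa using hcover
  · by_contra! hlt
    have h6 : (nod hX.1.1.toFinset u).card ≠ 6 := by
      obtain ⟨l, hl, rfl⟩ := hu.exists_isLinePoly
      have := hnm l hl
      rwa [nodesOn, show X ∩ lineSet l = ↑(nod hX.1.1.toFinset (lineSet l)) by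
        ext; simp [nod], Set.ncard_coe_finset] at this
    obtain ⟨A, hA⟩ := Finset.card_pos.mp (show 0 < (nod hX.1.1.toFinset u).card by omega)
    obtain ⟨hAX, hAu⟩ := mem_nod.mp hA
    rw [Set.Finite.mem_toFinset] at hAX
    have := card_le_card_of_cover (hline A hAX) hu (fun h => havoid A hAX u h hAu)
      (S := (nod hX.1.1.toFinset u).erase A)
      (fun P hP => (mem_nod.mp (Finset.mem_of_mem_erase hP)).2) fun P hP =>
        hcover A hAX P (by simpa using (mem_nod.mp (Finset.mem_of_mem_erase hP)).1)
          (Finset.ne_of_mem_erase hP)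
    rw [Finset.card_erase_of_mem hA] at this
    have := hcard A
    omega
  · simpa using hP

lemma MLineSeq.resCount_last_ne_three {X : Set (ℝ × ℝ)} (hX : GCSet 5 X)
    (hnm : NoMaximalLine 5 X) {A : ℝ × ℝ} (hA : A ∈ X) {L : Fin 5 → MvPolynomial (Fin 2) ℝ}
    (hL : MLineSeq X A L) : resCount X L 4 (L 4) ≠ 3 := by
  obtain ⟨us, h⟩ := hX.exists_config hnm
  obtain ⟨hl, hne, ⟨p, hp, c, rfl⟩, -⟩ := hL
  have hA' : A ∈ hX.1.1.toFinset := by simpa using hA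
  have hmem : ∀ i, lineSet (L i) ∈ us A := fun i => by
    refine h.mem_us_of_vanish hA' (ev_mem_PF hp.1) (fun h0 => ?_) (by simpa using hp.2.2)
      (hl i).isLn fun P hP => ?_
    · have := hp.2.1
      rw [h0] at this
      exact zero_ne_one this
    · have : ev (∏ i, L i) P = 0 := by
        rw [ev_prod]
        exact Finset.prod_eq_zero (Finset.mem_univ i) hP
      rw [ev, map_mul]
      exact mul_eq_zero_of_right _ this
  have key := h.card_residual_ne_three hA' (hmem 4)
    (s := (Finset.univ.filter (· < 4)).image fun i => lineSet (L i)) fun u hu => by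
      obtain ⟨i, hi, rfl⟩ := Finset.mem_image.mp hu
      exact Finset.mem_erase.mpr ⟨hne i 4 (Finset.mem_filter.mp hi).2.ne, hmem i⟩
  rw [← Set.ncard_coe_finset] at key
  rw [resCount]
  convert key using 3
  ext P
  simp [mem_nod, lineSet, and_assoc]

end Bridge

/-- in a `GC_5` set with no maximal line, no node has m-distribution
sequence `(5,5,4,3,3)` or `(5,4,4,4,3)`. -/
theorem no_55433_no_54443 (X : Set (ℝ × ℝ)) (hX : GCSet 5 X) (hnm : NoMaximalLine 5 X) :
    ∀ A ∈ X, ¬ HasMDSeq X A ![5, 5, 4, 3, 3] ∧ ¬ HasMDSeq X A ![5, 4, 4, 4, 3] := by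
  refine fun A hA => ⟨?_, ?_⟩ <;>
  · rintro ⟨L, hL, hk⟩
    exact hL.resCount_last_ne_three hX hnm hA (hk 4)
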